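/- arXiv:1812.03095 — 3 statements merged into one kernel-verified Lean document; each statement's English description precedes it below -/
import Mathlib

section
/- Let ε > 0 and let γ ∈ W^{1,1}((0,1);ℝ²) ∩ W^{2,1}_loc((0,1);ℝ²) be an immersed curve with E_ε(γ) < ∞. Then the constant-velocity reparametrization γ̃ of γ (i.e. the reparametrization with |γ̃'| ≡ L(γ) on (0,1)) lies in W^{2,2}((0,1);ℝ²) and satisfies E_ε(γ) = (1/L(γ)³)·∫₀¹ |γ̃''(t)|² dt + ε·L(γ). -/
open MeasureTheory Set Topology Filter

noncomputable section

/-- A function of class `W^{2,2}(0,1)`, identified with its `C¹([0,1])` representative: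
`u` has weak derivatives `du`, `ddu` (encoded through the fundamental theorem of calculus)
with `du, ddu ∈ L¹(0,1)` and `ddu ∈ L²(0,1)`. -/
structure W22 where
  u : ℝ → ℝ
  du : ℝ → ℝ
  ddu : ℝ → ℝ
  du_int : IntegrableOn du (Icc (0:ℝ) 1)
  ddu_int : IntegrableOn ddu (Icc (0:ℝ) 1)
  ddu_sq : IntegrableOn (fun x => (ddu x)^2) (Icc (0:ℝ) 1)
  ftc_u : ∀ x ∈ Icc (0:ℝ) 1, u x = u 0 + ∫ s in (0:ℝ)..x, du s
  ftc_du : ∀ x ∈ Icc (0:ℝ) 1, du x = du 0 + ∫ s in (0:ℝ)..x, ddu s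

/-- The elastic energy of a graph. -/
def graphE (f : W22) : ℝ :=
  ∫ x in Ioo (0:ℝ) 1, (f.ddu x)^2 / (1 + (f.du x)^2) ^ ((5:ℝ)/2)

/-- The length of a graph. -/
def graphLen (f : W22) : ℝ :=
  ∫ x in Ioo (0:ℝ) 1, Real.sqrt (1 + (f.du x)^2)

/-- The length-penalized elastic energy of a graph. -/
def graphPE (ε : ℝ) (f : W22) : ℝ := graphE f + ε * graphLen f

/-- Membership in the admissible class `G_ψ`. -/
def MemG (ψ : ℝ → ℝ) (f : W22) : Prop :=
  f.u 0 = 0 ∧ f.u 1 = 0 ∧ ∀ x ∈ Icc (0:ℝ) 1, ψ x ≤ f.u x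

/-- An admissible obstacle. -/
structure Admissible (ψ : ℝ → ℝ) : Prop where
  cont : ContinuousOn ψ (Icc 0 1)
  neg0 : ψ 0 < 0
  neg1 : ψ 1 < 0
  pos : ∃ x ∈ Icc (0:ℝ) 1, 0 < ψ x
  osd : ∃ C : ℝ, ∀ x ∈ Ioo (0:ℝ) 1,
      (∃ d : ℝ, |d| ≤ C ∧ HasDerivWithinAt ψ d (Ici x) x) ∧
      (∃ d : ℝ, |d| ≤ C ∧ HasDerivWithinAt ψ d (Iic x) x)

/-- `‖ψ'‖_∞`, the smallest uniform bound for the one-sided derivatives of `ψ` on `(0,1)`. -/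
def obstNorm (ψ : ℝ → ℝ) : ℝ :=
  sInf {C : ℝ | 0 ≤ C ∧ ∀ x ∈ Ioo (0:ℝ) 1, ∀ d : ℝ,
    (HasDerivWithinAt ψ d (Ici x) x ∨ HasDerivWithinAt ψ d (Iic x) x) → |d| ≤ C}

/-- A planar curve on `(0,1)` of class `W^{1,1}((0,1);ℝ²)`. -/
structure Curve1 where
  x : ℝ → ℝ
  y : ℝ → ℝ
  dx : ℝ → ℝ
  dy : ℝ → ℝ
  dx_int : IntegrableOn dx (Icc (0:ℝ) 1)
  dy_int : IntegrableOn dy (Icc (0:ℝ) 1)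
  ftc_x : ∀ t ∈ Icc (0:ℝ) 1, x t = x 0 + ∫ s in (0:ℝ)..t, dx s
  ftc_y : ∀ t ∈ Icc (0:ℝ) 1, y t = y 0 + ∫ s in (0:ℝ)..t, dy s

/-- A planar curve of class `W^{1,1}((0,1);ℝ²) ∩ W^{2,1}_loc((0,1);ℝ²)`. -/
structure Curve extends Curve1 where
  ddx : ℝ → ℝ
  ddy : ℝ → ℝ
  ddx_loc : ∀ a b : ℝ, 0 < a → b < 1 → IntegrableOn ddx (Icc a b)
  ddy_loc : ∀ a b : ℝ, 0 < a → b < 1 → IntegrableOn ddy (Icc a b)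
  ftc_dx : ∀ a ∈ Ioo (0:ℝ) 1, ∀ t ∈ Ioo (0:ℝ) 1, dx t = dx a + ∫ s in a..t, ddx s
  ftc_dy : ∀ a ∈ Ioo (0:ℝ) 1, ∀ t ∈ Ioo (0:ℝ) 1, dy t = dy a + ∫ s in a..t, ddy s

/-- `|γ'(t)|`. -/
def speed1 (γ : Curve1) (t : ℝ) : ℝ := Real.sqrt ((γ.dx t)^2 + (γ.dy t)^2)

/-- The length `L(γ) = ∫₀¹ |γ'| dt`, as an extended real number. -/
def len1E (γ : Curve1) : ENNReal := ∫⁻ t in Ioo (0:ℝ) 1, ENNReal.ofReal (speed1 γ t)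

/-- The length `L(γ)`, as a real number. -/
def len1 (γ : Curve1) : ℝ := ∫ t in Ioo (0:ℝ) 1, speed1 γ t

def lenE (γ : Curve) : ENNReal := len1E γ.toCurve1

/-- The integrand `⟨γ'', N_γ⟩²/|γ'|³` of the elastic energy. -/
def elInt (γ : Curve) (t : ℝ) : ℝ :=
  (γ.dx t * γ.ddy t - γ.dy t * γ.ddx t)^2 / ((γ.dx t)^2 + (γ.dy t)^2) ^ ((5:ℝ)/2)

/-- Elastic energy of a curve, as an extended real number. -/
def elE (γ : Curve) : ENNReal := ∫⁻ t in Ioo (0:ℝ) 1, ENNReal.ofReal (elInt γ t)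

/-- The length-penalized elastic energy `E_ε = E + ε·L`. -/
def penE (ε : ℝ) (γ : Curve) : ENNReal := elE γ + ENNReal.ofReal ε * lenE γ

/-- A curve is immersed if `|γ'| > ε` on `(0,1)` for some `ε > 0`. -/
def Curve.Immersed (γ : Curve) : Prop :=
  ∃ ε > 0, ∀ t ∈ Ioo (0:ℝ) 1, ε < speed1 γ.toCurve1 t

/-- `u` lies in `W^{2,2}_loc(c,d)` with weak derivatives `du`, `ddu`. -/
structure W22locOn (u du ddu : ℝ → ℝ) (c d : ℝ) : Prop where
  du_loc : ∀ a b : ℝ, c < a → b < d → IntegrableOn du (Icc a b)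
  ddu_loc : ∀ a b : ℝ, c < a → b < d → IntegrableOn ddu (Icc a b)
  ddu_sq : ∀ a b : ℝ, c < a → b < d → IntegrableOn (fun t => (ddu t)^2) (Icc a b)
  ftc_u : ∀ a ∈ Ioo c d, ∀ t ∈ Ioo c d, u t = u a + ∫ s in a..t, du s
  ftc_du : ∀ a ∈ Ioo c d, ∀ t ∈ Ioo c d, du t = du a + ∫ s in a..t, ddu s

/-- `γ` is a pseudograph. -/
def Pseudograph (γ : Curve) : Prop :=
  γ.Immersed ∧ (∀ t ∈ Ioo (0:ℝ) 1, 0 ≤ γ.dx t) ∧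
  ∀ a b : ℝ, 0 ≤ a → a < b → b ≤ 1 → (∀ t ∈ Ioo a b, 0 < γ.dx t) →
    ∃ u du ddu : ℝ → ℝ, W22locOn u du ddu (γ.x a) (γ.x b) ∧
      ∀ t ∈ Ioo a b, u (γ.x t) = γ.y t

/-- Membership in `P_ψ`. -/
def MemP (ψ : ℝ → ℝ) (γ : Curve) : Prop :=
  Pseudograph γ ∧ γ.x 0 = 0 ∧ γ.y 0 = 0 ∧ γ.x 1 = 1 ∧ γ.y 1 = 0 ∧
  ∀ t ∈ Icc (0:ℝ) 1, ψ (γ.x t) ≤ γ.y t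

/-- `v : (a,b) → (c,d)` is invertible in `W^{1,1}` (increasing case): it has an
inverse `w` which is again of class `W^{1,1}`. -/
def InvertibleW11On (v : ℝ → ℝ) (a b c d : ℝ) : Prop :=
  ∃ w dw : ℝ → ℝ, IntegrableOn dw (Icc c d) ∧
    (∀ s ∈ Icc c d, w s = w c + ∫ r in c..s, dw r) ∧
    (∀ t ∈ Ioo a b, v t ∈ Ioo c d ∧ w (v t) = t) ∧
    (∀ s ∈ Ioo c d, w s ∈ Ioo a b ∧ v (w s) = s)

/-- `γ ∈ M_{γ₀}`: a `∩`-shaped curve above `γ₀` with parameters `β₁, β₂` and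
graph reparametrization `u`. -/
structure CapAbove (γ : Curve1) (γ₀ : Curve) (β₁ β₂ : ℝ) (u : ℝ → ℝ) : Prop where
  ep0 : γ.x 0 = 0 ∧ γ.y 0 = 0
  ep1 : γ.x 1 = 1 ∧ γ.y 1 = 0
  hβ : 0 ≤ β₁ ∧ β₁ < β₂ ∧ β₂ ≤ 1
  left : ∀ t ∈ Icc (0:ℝ) β₁, γ.x t = 0
  right : ∀ t ∈ Icc β₂ (1:ℝ), γ.x t = 1
  inv : InvertibleW11On γ.x β₁ β₂ 0 1
  graph : ∀ t ∈ Ioo β₁ β₂, u (γ.x t) = γ.y t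
  ucont : ContinuousOn u (Icc (0:ℝ) 1)
  above : ∀ t ∈ Icc (0:ℝ) 1, γ₀.y t ≤ u (γ₀.x t)

/-- A `∩`-shaped pseudograph with parameters `β₁, β₂` and graph reparametrization `u`
(with weak derivatives `du`, `ddu`). -/
structure CapShaped (γ : Curve) (β₁ β₂ : ℝ) (u du ddu : ℝ → ℝ) : Prop where
  hβ : 0 ≤ β₁ ∧ β₁ < β₂ ∧ β₂ ≤ 1
  left : ∀ t ∈ Icc (0:ℝ) β₁, γ.x t = 0
  right : ∀ t ∈ Icc β₂ (1:ℝ), γ.x t = 1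
  pos : ∀ t ∈ Ioo β₁ β₂, 0 < γ.dx t
  graph : ∀ t ∈ Ioo β₁ β₂, u (γ.x t) = γ.y t
  reg : W22locOn u du ddu 0 1

/-- `G(x) = ∫₀ˣ (1+s²)^{-5/4} ds`. -/
def Gfun (x : ℝ) : ℝ := ∫ s in (0:ℝ)..x, ((1 + s^2) ^ (-(5:ℝ)/4) : ℝ)

/-- `c₀ = ∫_ℝ (1+s²)^{-5/4} ds`. -/
def c0 : ℝ := ∫ s : ℝ, ((1 + s^2) ^ (-(5:ℝ)/4) : ℝ)

/-- The inverse of `G`. -/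
def Ginv : ℝ → ℝ := Function.invFun Gfun

/-- The ratio `R(B)` from the nonexistence theorem. -/
def ratio (B : ℝ) : ℝ :=
  (∫ t in (0:ℝ)..B, t / (Real.sqrt (B - t) * (1 + t^2) ^ ((5:ℝ)/4))) /
  (2 * ∫ t in (0:ℝ)..B, 1 / (Real.sqrt (B - t) * (1 + t^2) ^ ((5:ℝ)/4)))

/-- The symmetric cone obstacle with valley `[0,s]` and peak `A`. -/
def coneObstacle (A s : ℝ) : ℝ → ℝ := fun x =>
  if x ≤ 1/2 then A / (1/2 - s) * (x - s) else A / (1/2 - s) * (1 - s - x)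
/-- Absolute continuity is preserved by composition with a Lipschitz function. -/
theorem LipschitzOnWith.comp_absolutelyContinuousOnInterval {g f : ℝ → ℝ} {K : NNReal}
    {S : Set ℝ} {a b : ℝ} (hg : LipschitzOnWith K g S) (hf : AbsolutelyContinuousOnInterval f a b)
    (hS : MapsTo f (uIcc a b) S) : AbsolutelyContinuousOnInterval (fun x ↦ g (f x)) a b := by
  have hK := Tendsto.const_mul (K : ℝ) hf
  rw [mul_zero] at hK
  refine squeeze_zero' (Eventually.of_forall fun E ↦ Finset.sum_nonneg fun i _ ↦ dist_nonneg)
    ?_ hK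
  refine (eventually_principal.2 fun E hE ↦ ?_).filter_mono inf_le_right
  rw [Finset.mul_sum]
  exact Finset.sum_le_sum fun i hi ↦
    hg.dist_le_mul _ (hS (hE.1 i hi).1) _ (hS (hE.1 i hi).2)

/-- The derivative of `p / √(p² + q²)` in terms of `p`, `q` and their derivatives. -/
def tangentDeriv (p q dp dq : ℝ) : ℝ := -q * (p * dq - q * dp) / √(p ^ 2 + q ^ 2) ^ 3

/-- Fundamental theorem of calculus for a component of the unit tangent. -/
theorem integral_tangentDeriv {p q dp dq : ℝ → ℝ} {a b m : ℝ} (hm : 0 < m)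
    (hp : AbsolutelyContinuousOnInterval p a b) (hq : AbsolutelyContinuousOnInterval q a b)
    (hdp : ∀ᵐ x, x ∈ uIcc a b → HasDerivAt p (dp x) x)
    (hdq : ∀ᵐ x, x ∈ uIcc a b → HasDerivAt q (dq x) x)
    (hpq : ∀ x ∈ uIcc a b, m ≤ p x ^ 2 + q x ^ 2) :
    ∫ x in a..b, tangentDeriv (p x) (q x) (dp x) (dq x)
      = p b / √(p b ^ 2 + q b ^ 2) - p a / √(p a ^ 2 + q a ^ 2) := by
  have hr : AbsolutelyContinuousOnInterval (fun x ↦ p x * p x + q x * q x) a b :=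
    (hp.fun_mul hp).fun_add (hq.fun_mul hq)
  obtain ⟨M, hM⟩ := hr.exists_bound
  have hcd : ContDiffOn ℝ 1 (fun z : ℝ ↦ (√z)⁻¹) (Icc m M) := fun z hz ↦
    ((contDiffAt_id.sqrt (hm.trans_le hz.1).ne').inv
      (Real.sqrt_pos.2 (hm.trans_le hz.1)).ne').contDiffWithinAt
  obtain ⟨K, hK⟩ := hcd.exists_lipschitzOnWith (by decide) (convex_Icc _ _) isCompact_Icc
  have hi := hK.comp_absolutelyContinuousOnInterval hr fun x hx ↦
    ⟨by nlinarith [hpq x hx], (le_abs_self _).trans (hM x hx)⟩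
  have hT := hp.fun_mul hi
  have h := hT.integral_deriv_eq_sub
  have hsq : ∀ x, p x * p x + q x * q x = p x ^ 2 + q x ^ 2 := fun x ↦ by ring
  simp only [hsq] at h
  simp only [div_eq_mul_inv]
  rw [← h]
  refine intervalIntegral.integral_congr_ae ?_
  filter_upwards [hdp, hdq] with x hx hx' hxm
  have hxI := uIoc_subset_uIcc hxm
  have hpos : 0 < p x ^ 2 + q x ^ 2 := hm.trans_le (hpq x hxI)
  have hs : √(p x ^ 2 + q x ^ 2) ≠ 0 := (Real.sqrt_pos.2 hpos).ne'
  have hd := (hx hxI).fun_mul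
    (((((hx hxI).fun_pow 2).fun_add ((hx' hxI).fun_pow 2)).sqrt hpos.ne').fun_inv hs)
  rw [hd.deriv, tangentDeriv]
  have hss : √(p x ^ 2 + q x ^ 2) ^ 2 = p x ^ 2 + q x ^ 2 := Real.sq_sqrt hpos.le
  generalize √(p x ^ 2 + q x ^ 2) = r at *
  field_simp
  simp only [hss]
  push_cast
  ring

/-- A function given by a local fundamental theorem of calculus is locally absolutely continuous
and differentiable almost everywhere. -/
theorem absolutelyContinuous_of_local_ftc {f g : ℝ → ℝ}
    (hloc : ∀ a b : ℝ, 0 < a → b < 1 → IntegrableOn g (Icc a b))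
    (hftc : ∀ a ∈ Ioo (0:ℝ) 1, ∀ t ∈ Ioo (0:ℝ) 1, f t = f a + ∫ s in a..t, g s)
    {s t : ℝ} (hs : s ∈ Ioo (0:ℝ) 1) (ht : t ∈ Ioo (0:ℝ) 1) :
    AbsolutelyContinuousOnInterval f s t ∧ ∀ᵐ x, x ∈ uIcc s t → HasDerivAt f (g x) x := by
  obtain ⟨c, hc0, hc⟩ : ∃ c, 0 < c ∧ c < min s t := exists_between (lt_min hs.1 ht.1)
  obtain ⟨d, hd, hd1⟩ : ∃ d, max s t < d ∧ d < 1 := exists_between (max_lt hs.2 ht.2)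
  have hcd : c ≤ d := by grind
  have hsub : uIcc s t ⊆ Ioo c d := fun x hx ↦ ⟨hc.trans_le hx.1, hx.2.trans_lt hd⟩
  have hint : IntervalIntegrable g volume c d :=
    IntegrableOn.intervalIntegrable (by rw [uIcc_of_le hcd]; exact hloc c d hc0 hd1)
  have heq : ∀ x ∈ Ioo c d, f x = f c + ∫ v in c..x, g v := fun x hx ↦
    hftc c ⟨hc0, by grind⟩ x ⟨hc0.trans hx.1, hx.2.trans hd1⟩
  constructor
  · have h1 := (hint.absolutelyContinuousOnInterval_intervalIntegral (c := c) (by simp)).mono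
      (hsub.trans (Ioo_subset_Icc_self.trans Icc_subset_uIcc))
    refine h1.congr' ?_
    refine (eventually_principal.2 fun E hE ↦ ?_).filter_mono inf_le_right
    refine Finset.sum_congr rfl fun i hi ↦ ?_
    rw [heq _ (hsub (hE.1 i hi).1), heq _ (hsub (hE.1 i hi).2), dist_add_left]
  · filter_upwards [hint.ae_hasDerivAt_integral] with x hx hxI
    have hx' := hx (Icc_subset_uIcc (Ioo_subset_Icc_self (hsub hxI))) c (by simp)
    refine (hx'.const_add (f c)).congr_of_eventuallyEq ?_
    filter_upwards [isOpen_Ioo.mem_nhds (hsub hxI)] with y hy using heq y hy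

/-- The primitive of a positive function is strictly increasing and differentiable. -/
theorem primitive_of_pos {v : ℝ → ℝ} (hint : IntegrableOn v (Icc (0:ℝ) 1))
    (hc : ContinuousOn v (Ioo (0:ℝ) 1)) (hpos : ∀ t ∈ Ioo (0:ℝ) 1, 0 < v t) :
    ContinuousOn (fun t ↦ ∫ s in (0:ℝ)..t, v s) (Icc 0 1) ∧
    (∀ t ∈ Ioo (0:ℝ) 1, HasDerivAt (fun t ↦ ∫ s in (0:ℝ)..t, v s) (v t) t) ∧
    StrictMonoOn (fun t ↦ ∫ s in (0:ℝ)..t, v s) (Icc 0 1) := by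
  have h1 : ContinuousOn (fun t ↦ ∫ s in (0:ℝ)..t, v s) (Icc 0 1) := by
    have := intervalIntegral.continuousOn_primitive_interval (μ := volume) (f := v)
      (a := 0) (b := 1) (by rwa [uIcc_of_le zero_le_one])
    rwa [uIcc_of_le zero_le_one] at this
  have h2 : ∀ t ∈ Ioo (0:ℝ) 1, HasDerivAt (fun t ↦ ∫ s in (0:ℝ)..t, v s) (v t) t := by
    intro t ht
    refine intervalIntegral.integral_hasDerivAt_right ?_ ?_
      (hc.continuousAt (isOpen_Ioo.mem_nhds ht))
    · exact (hint.mono_set (uIcc_subset_Icc (by simp) (Ioo_subset_Icc_self ht))).intervalIntegrable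
    · exact hc.stronglyMeasurableAtFilter isOpen_Ioo t ht
  refine ⟨h1, h2, strictMonoOn_of_deriv_pos (convex_Icc _ _) h1 fun t ht ↦ ?_⟩
  rw [interior_Icc] at ht
  rw [(h2 t ht).deriv]
  exact hpos t ht

/-- An increasing change of variables of the unit interval with positive derivative. -/
structure UnitChange (φ v : ℝ → ℝ) : Prop where
  cont : ContinuousOn φ (Icc 0 1)
  mono : StrictMonoOn φ (Icc 0 1)
  deriv : ∀ t ∈ Ioo (0:ℝ) 1, HasDerivAt φ (v t) t
  pos : ∀ t ∈ Ioo (0:ℝ) 1, 0 < v t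

namespace UnitChange

variable {φ v g h : ℝ → ℝ} {a b : ℝ}

theorem integrableOn_iff_and_setIntegral_eq (H : UnitChange φ v) (ha : a ∈ Icc (0:ℝ) 1)
    (hb : b ∈ Icc (0:ℝ) 1) (hab : a ≤ b) (hgh : ∀ t ∈ Ioo (0:ℝ) 1, v t * g (φ t) = h t) :
    (IntegrableOn g (Ioo (φ a) (φ b)) ↔ IntegrableOn h (Ioo a b)) ∧
    ∫ x in Ioo (φ a) (φ b), g x = ∫ x in Ioo a b, h x := by
  have hI : Icc a b ⊆ Icc 0 1 := Icc_subset_Icc ha.1 hb.2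
  have hO : Ioo a b ⊆ Ioo 0 1 := Ioo_subset_Ioo ha.1 hb.2
  have himg := (H.cont.mono hI).image_Ioo_of_strictMonoOn hab (H.mono.mono hI)
  have hder : ∀ x ∈ Ioo a b, HasDerivWithinAt φ (v x) (Ioo a b) x := fun x hx ↦
    (H.deriv x (hO hx)).hasDerivWithinAt
  have hinj : InjOn φ (Ioo a b) := (H.mono.mono (Ioo_subset_Icc_self.trans hI)).injOn
  have heq : ∀ x ∈ Ioo a b, |v x| • g (φ x) = h x := fun x hx ↦ by
    rw [abs_of_pos (H.pos x (hO hx)), smul_eq_mul, hgh x (hO hx)]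
  rw [← himg, integrableOn_image_iff_integrableOn_abs_deriv_smul measurableSet_Ioo hder hinj,
    integral_image_eq_integral_abs_deriv_smul measurableSet_Ioo hder hinj]
  exact ⟨integrableOn_congr_fun heq measurableSet_Ioo, setIntegral_congr_fun measurableSet_Ioo heq⟩

theorem intervalIntegral_eq (H : UnitChange φ v) (ha : a ∈ Icc (0:ℝ) 1)
    (hb : b ∈ Icc (0:ℝ) 1) (hgh : ∀ t ∈ Ioo (0:ℝ) 1, v t * g (φ t) = h t) :
    ∫ x in φ a..φ b, g x = ∫ x in a..b, h x := by
  wlog hab : a ≤ b generalizing a b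
  · rw [intervalIntegral.integral_symm, this hb ha (le_of_not_ge hab),
      ← intervalIntegral.integral_symm]
  rw [intervalIntegral.integral_of_le (H.mono.monotoneOn ha hb hab),
    intervalIntegral.integral_of_le hab, integral_Ioc_eq_integral_Ioo,
    integral_Ioc_eq_integral_Ioo]
  exact (H.integrableOn_iff_and_setIntegral_eq ha hb hab hgh).2

end UnitChange

/-- The curve with prescribed second derivative, whose velocity at time `c` is `(p, q)` and whose
initial point is `(x₀, y₀)`. -/
def curveOfSecondDeriv (x₀ y₀ p q c : ℝ) (hc : c ∈ Icc (0:ℝ) 1) (g h : ℝ → ℝ)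
    (hg : IntegrableOn g (Icc (0:ℝ) 1)) (hh : IntegrableOn h (Icc (0:ℝ) 1)) : Curve where
  x t := x₀ + ∫ s in (0:ℝ)..t, (p + ∫ r in c..s, g r)
  y t := y₀ + ∫ s in (0:ℝ)..t, (q + ∫ r in c..s, h r)
  dx t := p + ∫ r in c..t, g r
  dy t := q + ∫ r in c..t, h r
  dx_int := ((continuousOn_const.add (intervalIntegral.continuousOn_primitive_interval'
    ((uIcc_of_le (zero_le_one' ℝ)).symm ▸ hg).intervalIntegrable
    ((uIcc_of_le (zero_le_one' ℝ)).symm ▸ hc))).integrableOn_compact isCompact_uIcc).mono_set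
    Icc_subset_uIcc
  dy_int := ((continuousOn_const.add (intervalIntegral.continuousOn_primitive_interval'
    ((uIcc_of_le (zero_le_one' ℝ)).symm ▸ hh).intervalIntegrable
    ((uIcc_of_le (zero_le_one' ℝ)).symm ▸ hc))).integrableOn_compact isCompact_uIcc).mono_set
    Icc_subset_uIcc
  ftc_x _ _ := by simp
  ftc_y _ _ := by simp
  ddx := g
  ddy := h
  ddx_loc _ _ ha hb := hg.mono_set (Icc_subset_Icc ha.le hb.le)
  ddy_loc _ _ ha hb := hh.mono_set (Icc_subset_Icc ha.le hb.le)
  ftc_dx a ha t ht := by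
    have hi : ∀ u ∈ Icc (0:ℝ) 1, ∀ w ∈ Icc (0:ℝ) 1, IntervalIntegrable g volume u w :=
      fun u hu w hw ↦ (hg.mono_set (uIcc_subset_Icc hu hw)).intervalIntegrable
    rw [add_assoc, intervalIntegral.integral_add_adjacent_intervals
      (hi _ hc _ (Ioo_subset_Icc_self ha))
      (hi _ (Ioo_subset_Icc_self ha) _ (Ioo_subset_Icc_self ht))]
  ftc_dy a ha t ht := by
    have hi : ∀ u ∈ Icc (0:ℝ) 1, ∀ w ∈ Icc (0:ℝ) 1, IntervalIntegrable h volume u w :=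
      fun u hu w hw ↦ (hh.mono_set (uIcc_subset_Icc hu hw)).intervalIntegrable
    rw [add_assoc, intervalIntegral.integral_add_adjacent_intervals
      (hi _ hc _ (Ioo_subset_Icc_self ha))
      (hi _ (Ioo_subset_Icc_self ha) _ (Ioo_subset_Icc_self ht))]


namespace Curve

variable {γ : Curve}

theorem Immersed.speed1_pos (himm : γ.Immersed) {t : ℝ} (ht : t ∈ Ioo (0:ℝ) 1) :
    0 < speed1 γ.toCurve1 t := by
  obtain ⟨δ, hδ, h⟩ := himm
  exact hδ.trans (h t ht)

theorem continuousOn_dx (γ : Curve) : ContinuousOn γ.dx (Ioo (0:ℝ) 1) := fun t ht ↦ by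
  obtain ⟨c, hc0, hc⟩ := exists_between ht.1
  obtain ⟨d, hd, hd1⟩ := exists_between ht.2
  have h := (absolutelyContinuous_of_local_ftc γ.ddx_loc γ.ftc_dx
    ⟨hc0, hc.trans ht.2⟩ ⟨ht.1.trans hd, hd1⟩).1.continuousOn
  rw [uIcc_of_le (hc.trans hd).le] at h
  exact (h.continuousAt (Icc_mem_nhds hc hd)).continuousWithinAt

theorem continuousOn_dy (γ : Curve) : ContinuousOn γ.dy (Ioo (0:ℝ) 1) := fun t ht ↦ by
  obtain ⟨c, hc0, hc⟩ := exists_between ht.1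
  obtain ⟨d, hd, hd1⟩ := exists_between ht.2
  have h := (absolutelyContinuous_of_local_ftc γ.ddy_loc γ.ftc_dy
    ⟨hc0, hc.trans ht.2⟩ ⟨ht.1.trans hd, hd1⟩).1.continuousOn
  rw [uIcc_of_le (hc.trans hd).le] at h
  exact (h.continuousAt (Icc_mem_nhds hc hd)).continuousWithinAt

theorem continuousOn_speed1 (γ : Curve) : ContinuousOn (speed1 γ.toCurve1) (Ioo (0:ℝ) 1) :=
  ((γ.continuousOn_dx.pow 2).add (γ.continuousOn_dy.pow 2)).sqrt

theorem integrableOn_speed1 (γ : Curve) : IntegrableOn (speed1 γ.toCurve1) (Icc (0:ℝ) 1) := by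
  rw [integrableOn_Icc_iff_integrableOn_Ioo]
  refine Integrable.mono'
    ((γ.dx_int.mono_set Ioo_subset_Icc_self).abs.add (γ.dy_int.mono_set Ioo_subset_Icc_self).abs)
    (γ.continuousOn_speed1.aestronglyMeasurable measurableSet_Ioo)
    (Eventually.of_forall fun t ↦ ?_)
  rw [speed1, Real.norm_of_nonneg (Real.sqrt_nonneg _)]
  refine Real.sqrt_le_iff.2 ⟨by simp only [Pi.add_apply]; positivity, ?_⟩
  simp only [Pi.add_apply]
  nlinarith [sq_abs (γ.dx t), sq_abs (γ.dy t), abs_nonneg (γ.dx t), abs_nonneg (γ.dy t),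
    mul_nonneg (abs_nonneg (γ.dx t)) (abs_nonneg (γ.dy t))]

theorem speed1_sq (γ : Curve) (t : ℝ) :
    speed1 γ.toCurve1 t ^ 2 = γ.dx t ^ 2 + γ.dy t ^ 2 :=
  Real.sq_sqrt (by positivity)

theorem elInt_eq (γ : Curve) (t : ℝ) :
    elInt γ t = (γ.dx t * γ.ddy t - γ.dy t * γ.ddx t) ^ 2 / speed1 γ.toCurve1 t ^ 5 := by
  have h : 0 ≤ γ.dx t ^ 2 + γ.dy t ^ 2 := by positivity
  rw [elInt, speed1, Real.sqrt_eq_rpow, ← Real.rpow_mul_natCast h]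
  norm_num

/-- The derivative of the first component of the unit tangent. -/
def tangentDerivX (γ : Curve) (t : ℝ) : ℝ := tangentDeriv (γ.dx t) (γ.dy t) (γ.ddx t) (γ.ddy t)

/-- The derivative of the second component of the unit tangent. -/
def tangentDerivY (γ : Curve) (t : ℝ) : ℝ := tangentDeriv (γ.dy t) (γ.dx t) (γ.ddy t) (γ.ddx t)

theorem tangentDerivX_eq (γ : Curve) (t : ℝ) : γ.tangentDerivX t
    = -γ.dy t * (γ.dx t * γ.ddy t - γ.dy t * γ.ddx t) / speed1 γ.toCurve1 t ^ 3 := rfl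

theorem tangentDerivY_eq (γ : Curve) (t : ℝ) : γ.tangentDerivY t
    = γ.dx t * (γ.dx t * γ.ddy t - γ.dy t * γ.ddx t) / speed1 γ.toCurve1 t ^ 3 := by
  rw [tangentDerivY, tangentDeriv, speed1, add_comm (γ.dy t ^ 2)]
  ring

theorem tangentDeriv_sq_add_sq {t : ℝ} (ht : 0 < speed1 γ.toCurve1 t) :
    γ.tangentDerivX t ^ 2 + γ.tangentDerivY t ^ 2 = speed1 γ.toCurve1 t * elInt γ t := by
  rw [tangentDerivX_eq, tangentDerivY_eq, elInt_eq]
  have h := γ.speed1_sq t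
  generalize speed1 γ.toCurve1 t = r at *
  generalize γ.dx t * γ.ddy t - γ.dy t * γ.ddx t = w at *
  field_simp
  rw [h]
  ring

theorem integral_tangentDerivX (himm : γ.Immersed) {a b : ℝ} (ha : a ∈ Ioo (0:ℝ) 1)
    (hb : b ∈ Ioo (0:ℝ) 1) : ∫ t in a..b, γ.tangentDerivX t
      = γ.dx b / speed1 γ.toCurve1 b - γ.dx a / speed1 γ.toCurve1 a := by
  obtain ⟨δ, hδ, h⟩ := himm
  have hx := absolutelyContinuous_of_local_ftc γ.ddx_loc γ.ftc_dx ha hb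
  have hy := absolutelyContinuous_of_local_ftc γ.ddy_loc γ.ftc_dy ha hb
  refine integral_tangentDeriv (sq_pos_of_pos hδ) hx.1 hy.1 hx.2 hy.2 fun x hxI ↦ ?_
  rw [← γ.speed1_sq]
  exact pow_le_pow_left₀ hδ.le (h x (ordConnected_Ioo.uIcc_subset ha hb hxI)).le 2

theorem integral_tangentDerivY (himm : γ.Immersed) {a b : ℝ} (ha : a ∈ Ioo (0:ℝ) 1)
    (hb : b ∈ Ioo (0:ℝ) 1) : ∫ t in a..b, γ.tangentDerivY t
      = γ.dy b / speed1 γ.toCurve1 b - γ.dy a / speed1 γ.toCurve1 a := by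
  obtain ⟨δ, hδ, h⟩ := himm
  have hx := absolutelyContinuous_of_local_ftc γ.ddx_loc γ.ftc_dx ha hb
  have hy := absolutelyContinuous_of_local_ftc γ.ddy_loc γ.ftc_dy ha hb
  have hI := integral_tangentDeriv (sq_pos_of_pos hδ) hy.1 hx.1 hy.2 hx.2 fun x hxI ↦ by
    rw [add_comm, ← γ.speed1_sq]
    exact pow_le_pow_left₀ hδ.le (h x (ordConnected_Ioo.uIcc_subset ha hb hxI)).le 2
  simpa only [tangentDerivY, speed1, add_comm (γ.dx _ ^ 2)] using hI

theorem aestronglyMeasurable_of_local {g : ℝ → ℝ}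
    (hloc : ∀ a b : ℝ, 0 < a → b < 1 → IntegrableOn g (Icc a b)) :
    AEStronglyMeasurable g (volume.restrict (Ioo (0:ℝ) 1)) := by
  refine LocallyIntegrableOn.aestronglyMeasurable fun t ht ↦ ?_
  obtain ⟨c, hc0, hc⟩ := exists_between ht.1
  obtain ⟨d, hd, hd1⟩ := exists_between ht.2
  exact ⟨Icc c d, mem_nhdsWithin_of_mem_nhds (Icc_mem_nhds hc hd), hloc c d hc0 hd1⟩

theorem abs_le_of_sq_add_sq_eq {x y r e : ℝ} (hr : 0 < r) (h : x ^ 2 + y ^ 2 = r * e) :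
    |x| ≤ r + e := by
  have he : 0 ≤ e := nonneg_of_mul_nonneg_right (h ▸ by positivity) hr
  refine abs_le_of_sq_le_sq ?_ (by positivity)
  nlinarith [sq_nonneg y, mul_nonneg hr.le he]

theorem integrableOn_tangentDeriv (himm : γ.Immersed)
    (hfin : IntegrableOn (elInt γ) (Ioo (0:ℝ) 1)) :
    IntegrableOn γ.tangentDerivX (Ioo (0:ℝ) 1) ∧ IntegrableOn γ.tangentDerivY (Ioo (0:ℝ) 1) := by
  have mx := γ.continuousOn_dx.aestronglyMeasurable measurableSet_Ioo (μ := volume)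
  have my := γ.continuousOn_dy.aestronglyMeasurable measurableSet_Ioo (μ := volume)
  have mxx := aestronglyMeasurable_of_local γ.ddx_loc
  have myy := aestronglyMeasurable_of_local γ.ddy_loc
  have ms := γ.continuousOn_speed1.aestronglyMeasurable measurableSet_Ioo (μ := volume)
  have hw := (mx.mul myy).sub (my.mul mxx)
  have hb := (γ.integrableOn_speed1.mono_set Ioo_subset_Icc_self).add hfin
  constructor
  · refine Integrable.mono' hb ((my.neg.mul hw).div₀ (ms.pow 3)) ?_
    refine (ae_restrict_iff' measurableSet_Ioo).2 (Eventually.of_forall fun t ht ↦ ?_)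
    exact abs_le_of_sq_add_sq_eq (himm.speed1_pos ht) (tangentDeriv_sq_add_sq (himm.speed1_pos ht))
  · have e : γ.tangentDerivY = fun t ↦ γ.dx t * (γ.dx t * γ.ddy t - γ.dy t * γ.ddx t) /
        speed1 γ.toCurve1 t ^ 3 := funext γ.tangentDerivY_eq
    refine Integrable.mono' hb (e ▸ (mx.mul hw).div₀ (ms.pow 3)) ?_
    refine (ae_restrict_iff' measurableSet_Ioo).2 (Eventually.of_forall fun t ht ↦ ?_)
    exact abs_le_of_sq_add_sq_eq (himm.speed1_pos ht)
      ((add_comm _ _).trans (tangentDeriv_sq_add_sq (himm.speed1_pos ht)))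

/-- The arc length of `γ` on `[0, t]`, divided by the length of `γ`. -/
def arc (γ : Curve) (t : ℝ) : ℝ := (∫ s in (0:ℝ)..t, speed1 γ.toCurve1 s) / len1 γ.toCurve1

theorem len1_eq (γ : Curve) : len1 γ.toCurve1 = ∫ s in (0:ℝ)..1, speed1 γ.toCurve1 s := by
  rw [intervalIntegral.integral_of_le zero_le_one, integral_Ioc_eq_integral_Ioo, len1]

theorem Immersed.len1_pos (himm : γ.Immersed) : 0 < len1 γ.toCurve1 := by
  have h := (primitive_of_pos γ.integrableOn_speed1 γ.continuousOn_speed1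
    fun _ ↦ himm.speed1_pos).2.2 (left_mem_Icc.2 zero_le_one) (right_mem_Icc.2 zero_le_one)
    zero_lt_one
  rw [len1_eq]
  simpa using h

theorem arc_zero (γ : Curve) : γ.arc 0 = 0 := by simp [arc]

theorem Immersed.arc_one (himm : γ.Immersed) : γ.arc 1 = 1 := by
  rw [arc, ← len1_eq, div_self himm.len1_pos.ne']

theorem Immersed.unitChange_arc (himm : γ.Immersed) :
    UnitChange γ.arc (fun t ↦ speed1 γ.toCurve1 t / len1 γ.toCurve1) := by
  obtain ⟨h1, h2, h3⟩ := primitive_of_pos γ.integrableOn_speed1 γ.continuousOn_speed1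
    fun _ ↦ himm.speed1_pos
  exact ⟨h1.div_const _, fun a ha b hb hab ↦ div_lt_div_of_pos_right (h3 ha hb hab) himm.len1_pos,
    fun t ht ↦ (h2 t ht).div_const _, fun t ht ↦ div_pos (himm.speed1_pos ht) himm.len1_pos⟩

end Curve

/-- The constant-velocity reparametrization of an immersed curve with finite
penalized energy lies in `W^{2,2}((0,1);ℝ²)` and satisfies
`E_ε(γ) = L(γ)⁻³ ∫₀¹|γ̃''|² + ε L(γ)`. -/
theorem stmt6 (ε : ℝ) (hε : 0 < ε) (γ : Curve) (himm : γ.Immersed)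
    (hfin : IntegrableOn (elInt γ) (Ioo (0:ℝ) 1)) :
    ∃ (γt : Curve) (φ : ℝ → ℝ),
      -- γt ∈ W^{2,2}((0,1);ℝ²)
      IntegrableOn γt.ddx (Icc (0:ℝ) 1) ∧ IntegrableOn γt.ddy (Icc (0:ℝ) 1) ∧
      IntegrableOn (fun t => (γt.ddx t)^2 + (γt.ddy t)^2) (Icc (0:ℝ) 1) ∧
      (∀ t ∈ Icc (0:ℝ) 1, γt.dx t = γt.dx 0 + ∫ s in (0:ℝ)..t, γt.ddx s) ∧
      (∀ t ∈ Icc (0:ℝ) 1, γt.dy t = γt.dy 0 + ∫ s in (0:ℝ)..t, γt.ddy s) ∧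
      -- γt is a reparametrization of γ via φ
      ContinuousOn φ (Icc (0:ℝ) 1) ∧ StrictMonoOn φ (Icc (0:ℝ) 1) ∧
      φ 0 = 0 ∧ φ 1 = 1 ∧
      (∀ t ∈ Icc (0:ℝ) 1, γt.x (φ t) = γ.x t ∧ γt.y (φ t) = γ.y t) ∧
      -- γt has constant velocity L(γ)
      (∀ t ∈ Ioo (0:ℝ) 1, speed1 γt.toCurve1 t = len1 γ.toCurve1) ∧
      -- the energy identity
      (∫ t in Ioo (0:ℝ) 1, elInt γ t) + ε * len1 γ.toCurve1
        = (1 / (len1 γ.toCurve1)^3) * (∫ t in Ioo (0:ℝ) 1, ((γt.ddx t)^2 + (γt.ddy t)^2))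
          + ε * len1 γ.toCurve1 := by
  have H := himm.unitChange_arc
  have hL := himm.len1_pos
  have h0 : γ.arc 0 = 0 := γ.arc_zero
  have h1 : γ.arc 1 = 1 := himm.arc_one
  have m0 : (0:ℝ) ∈ Icc (0:ℝ) 1 := by simp
  have m1 : (1:ℝ) ∈ Icc (0:ℝ) 1 := by simp
  have mh : (1 / 2 : ℝ) ∈ Ioo (0:ℝ) 1 := by constructor <;> norm_num
  have himgI : ∀ t ∈ Icc (0:ℝ) 1, γ.arc t ∈ Icc (0:ℝ) 1 := fun t ht ↦
    ⟨h0 ▸ H.mono.monotoneOn m0 ht ht.1, h1 ▸ H.mono.monotoneOn ht m1 ht.2⟩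
  have himg : γ.arc '' Ioo 0 1 = Ioo 0 1 := by
    rw [H.cont.image_Ioo_of_strictMonoOn zero_le_one H.mono, h0, h1]
  set L := len1 γ.toCurve1 with hLdef
  set τ := Function.invFunOn γ.arc (Icc 0 1)
  have hτ : ∀ t ∈ Ioo (0:ℝ) 1, τ (γ.arc t) = t := fun t ht ↦
    H.mono.injOn.leftInvOn_invFunOn (Ioo_subset_Icc_self ht)
  set gx : ℝ → ℝ := fun s ↦ L ^ 2 * γ.tangentDerivX (τ s) / speed1 γ.toCurve1 (τ s) with hgx
  set gy : ℝ → ℝ := fun s ↦ L ^ 2 * γ.tangentDerivY (τ s) / speed1 γ.toCurve1 (τ s) with hgy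
  have cx : ∀ t ∈ Ioo (0:ℝ) 1,
      speed1 γ.toCurve1 t / L * gx (γ.arc t) = L * γ.tangentDerivX t := fun t ht ↦ by
    have := himm.speed1_pos ht
    simp only [hgx, hτ t ht]
    field_simp
  have cy : ∀ t ∈ Ioo (0:ℝ) 1,
      speed1 γ.toCurve1 t / L * gy (γ.arc t) = L * γ.tangentDerivY t := fun t ht ↦ by
    have := himm.speed1_pos ht
    simp only [hgy, hτ t ht]
    field_simp
  have csq : ∀ t ∈ Ioo (0:ℝ) 1, speed1 γ.toCurve1 t / L *
      (fun s ↦ gx s ^ 2 + gy s ^ 2) (γ.arc t) = L ^ 3 * elInt γ t := fun t ht ↦ by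
    have hs := himm.speed1_pos ht
    have h := Curve.tangentDeriv_sq_add_sq hs
    have h' : elInt γ t = (γ.tangentDerivX t ^ 2 + γ.tangentDerivY t ^ 2) /
        speed1 γ.toCurve1 t := by rw [h]; field_simp
    simp only [hgx, hgy, hτ t ht, h']
    field_simp
  obtain ⟨ix, iy⟩ := Curve.integrableOn_tangentDeriv himm hfin
  have kx := (H.integrableOn_iff_and_setIntegral_eq m0 m1 zero_le_one cx).1
  have ky := (H.integrableOn_iff_and_setIntegral_eq m0 m1 zero_le_one cy).1
  have ksq := H.integrableOn_iff_and_setIntegral_eq (g := fun s ↦ gx s ^ 2 + gy s ^ 2) m0 m1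
    zero_le_one csq
  rw [h0, h1] at kx ky ksq
  have jx : IntegrableOn gx (Icc (0:ℝ) 1) :=
    (integrableOn_Icc_iff_integrableOn_Ioo (by simp) (by simp)).2 (kx.2 (ix.const_mul L))
  have jy : IntegrableOn gy (Icc (0:ℝ) 1) :=
    (integrableOn_Icc_iff_integrableOn_Ioo (by simp) (by simp)).2 (ky.2 (iy.const_mul L))
  have mc := himgI _ (Ioo_subset_Icc_self mh)
  set γt : Curve := curveOfSecondDeriv (γ.x 0) (γ.y 0)
    (L * (γ.dx (1 / 2) / speed1 γ.toCurve1 (1 / 2)))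
    (L * (γ.dy (1 / 2) / speed1 γ.toCurve1 (1 / 2))) (γ.arc (1 / 2)) mc gx gy jx jy
  have dx_arc : ∀ t ∈ Ioo (0:ℝ) 1,
      γt.dx (γ.arc t) = L * (γ.dx t / speed1 γ.toCurve1 t) := fun t ht ↦ by
    change _ + ∫ r in γ.arc (1 / 2)..γ.arc t, gx r = _
    rw [H.intervalIntegral_eq (Ioo_subset_Icc_self mh) (Ioo_subset_Icc_self ht) cx,
      intervalIntegral.integral_const_mul, Curve.integral_tangentDerivX himm mh ht]
    ring
  have dy_arc : ∀ t ∈ Ioo (0:ℝ) 1,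
      γt.dy (γ.arc t) = L * (γ.dy t / speed1 γ.toCurve1 t) := fun t ht ↦ by
    change _ + ∫ r in γ.arc (1 / 2)..γ.arc t, gy r = _
    rw [H.intervalIntegral_eq (Ioo_subset_Icc_self mh) (Ioo_subset_Icc_self ht) cy,
      intervalIntegral.integral_const_mul, Curve.integral_tangentDerivY himm mh ht]
    ring
  refine ⟨γt, γ.arc, jx, jy, (integrableOn_Icc_iff_integrableOn_Ioo (by simp) (by simp)).2
    (ksq.1.2 (hfin.const_mul _)), fun t ht ↦ ?_, fun t ht ↦ ?_, H.cont, H.mono, h0, h1,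
    fun t ht ↦ ⟨?_, ?_⟩, fun s hs ↦ ?_, ?_⟩
  · have hi : ∀ u ∈ Icc (0:ℝ) 1, ∀ w ∈ Icc (0:ℝ) 1, IntervalIntegrable gx volume u w :=
      fun u hu w hw ↦ (jx.mono_set (uIcc_subset_Icc hu hw)).intervalIntegrable
    change _ + ∫ r in γ.arc (1 / 2)..t, gx r = _ + (∫ r in γ.arc (1 / 2)..0, gx r) + ∫ r in (0:ℝ)..t, gx r
    rw [add_assoc, intervalIntegral.integral_add_adjacent_intervals
      (hi _ mc _ m0) (hi _ m0 _ ht)]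
  · have hi : ∀ u ∈ Icc (0:ℝ) 1, ∀ w ∈ Icc (0:ℝ) 1, IntervalIntegrable gy volume u w :=
      fun u hu w hw ↦ (jy.mono_set (uIcc_subset_Icc hu hw)).intervalIntegrable
    change _ + ∫ r in γ.arc (1 / 2)..t, gy r = _ + (∫ r in γ.arc (1 / 2)..0, gy r) + ∫ r in (0:ℝ)..t, gy r
    rw [add_assoc, intervalIntegral.integral_add_adjacent_intervals
      (hi _ mc _ m0) (hi _ m0 _ ht)]
  · have h := H.intervalIntegral_eq (g := γt.dx) (h := γ.dx) m0 ht fun t ht ↦ by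
      have := himm.speed1_pos ht
      rw [dx_arc t ht]
      field_simp
    rw [γt.ftc_x _ (himgI t ht), γ.ftc_x t ht, ← h, h0]
    simp [γt, curveOfSecondDeriv]
  · have h := H.intervalIntegral_eq (g := γt.dy) (h := γ.dy) m0 ht fun t ht ↦ by
      have := himm.speed1_pos ht
      rw [dy_arc t ht]
      field_simp
    rw [γt.ftc_y _ (himgI t ht), γ.ftc_y t ht, ← h, h0]
    simp [γt, curveOfSecondDeriv]
  · rw [← himg] at hs
    obtain ⟨t, ht, rfl⟩ := hs
    have := himm.speed1_pos ht
    rw [speed1, dx_arc t ht, dy_arc t ht, Real.sqrt_eq_iff_eq_sq (by positivity) hL.le]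
    have h := γ.speed1_sq t
    field_simp
    exact h.symm
  · have h : ∫ t in Ioo (0:ℝ) 1, (γt.ddx t ^ 2 + γt.ddy t ^ 2)
        = ∫ t in Ioo (0:ℝ) 1, L ^ 3 * elInt γ t := ksq.2
    rw [h, integral_const_mul]
    field_simp
end
end

section
/- Let ψ be an admissible obstacle, ε ≥ 0, and let u ∈ G_ψ satisfy E_ε(u) = inf_{v ∈ G_ψ} E_ε(v), where E_ε(u) = ∫₀¹ u''²/(1+u'²)^{5/2} dx + ε·∫₀¹ √(1+u'²) dx. Then u is concave. -/
open MeasureTheory Set Topology Filter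

noncomputable section

/-- A continuous function that is not concave lies below a line which touches its graph at two
points `a < b` but not at some `z` between them. -/
theorem exists_supporting_chord {f : ℝ → ℝ} (hf : ContinuousOn f (Icc (0:ℝ) 1))
    (hnc : ¬ ConcaveOn ℝ (Icc (0:ℝ) 1) f) :
    ∃ a b z m : ℝ, 0 ≤ a ∧ a < z ∧ z < b ∧ b ≤ 1 ∧ f z < f a + m * (z - a) ∧
      f b = f a + m * (b - a) ∧ ∀ x ∈ Icc (0:ℝ) 1, f x ≤ f a + m * (x - a) := by
  obtain ⟨z, x, y, t, hx, hy, ht, hxz, hzy, hz, hlt⟩ : ∃ z x y t : ℝ, x ∈ Icc (0:ℝ) 1 ∧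
      y ∈ Icc (0:ℝ) 1 ∧ t ∈ Icc (0:ℝ) 1 ∧ x ≤ z ∧ z ≤ y ∧ t * x + (1 - t) * y = z ∧
      f z < t * f x + (1 - t) * f y := by
    by_contra hcon
    push Not at hcon
    refine hnc ⟨convex_Icc 0 1, fun x hx y hy α β hα hβ hαβ => ?_⟩
    simp only [smul_eq_mul]
    rcases le_total x y with hxy | hxy
    · have hβ' : β = 1 - α := by linarith
      subst hβ'
      exact hcon _ x y α hx hy ⟨hα, by linarith⟩ (by nlinarith) (by nlinarith) rfl
    · have hα' : α = 1 - β := by linarith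
      subst hα'
      have := hcon _ y x β hy hx ⟨hβ, by linarith⟩ (by nlinarith) (by nlinarith) rfl
      rw [add_comm, add_comm ((1 - β) * x)]
      exact this
  have hz0 : 0 ≤ z := hx.1.trans hxz
  have hz1 : z ≤ 1 := hzy.trans hy.2
  set K : Set (ℝ × ℝ × ℝ) := (Icc 0 z ×ˢ (Icc z 1 ×ˢ Icc 0 1)) ∩
    {p | p.2.2 * p.1 + (1 - p.2.2) * p.2.1 = z}
  have hKc : IsCompact K := by
    refine (isCompact_Icc.prod (isCompact_Icc.prod isCompact_Icc)).inter_right ?_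
    exact isClosed_eq (by fun_prop) continuous_const
  have hKf : ContinuousOn (fun p : ℝ × ℝ × ℝ => p.2.2 * f p.1 + (1 - p.2.2) * f p.2.1) K := by
    have h1 : ContinuousOn (fun p : ℝ × ℝ × ℝ => f p.1) K :=
      hf.comp (by fun_prop) fun p hp => ⟨hp.1.1.1, hp.1.1.2.trans hz1⟩
    have h2 : ContinuousOn (fun p : ℝ × ℝ × ℝ => f p.2.1) K :=
      hf.comp (by fun_prop) fun p hp => ⟨hz0.trans hp.1.2.1.1, hp.1.2.1.2⟩
    have h3 : ContinuousOn (fun p : ℝ × ℝ × ℝ => p.2.2) K := by fun_prop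
    exact (h3.mul h1).add ((continuousOn_const.sub h3).mul h2)
  obtain ⟨⟨a, b, s⟩, hmem, hmax⟩ := hKc.exists_isMaxOn
    ⟨(x, y, t), ⟨⟨⟨hx.1, hxz⟩, ⟨hzy, hy.2⟩, ht⟩, hz⟩⟩ hKf
  obtain ⟨⟨⟨ha0, haz⟩, ⟨hzb, hb1⟩, hs0, hs1⟩, hsz⟩ := hmem
  simp only [mem_ofPred_eq] at ha0 haz hzb hb1 hs0 hs1 hsz
  have hmax' : ∀ a' b' s' : ℝ, 0 ≤ a' → a' ≤ z → z ≤ b' → b' ≤ 1 → 0 ≤ s' → s' ≤ 1 →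
      s' * a' + (1 - s') * b' = z →
      s' * f a' + (1 - s') * f b' ≤ s * f a + (1 - s) * f b :=
    fun a' b' s' h1 h2 h3 h4 h5 h6 h7 =>
      hmax (show (a', b', s') ∈ K from ⟨⟨⟨h1, h2⟩, ⟨h3, h4⟩, h5, h6⟩, h7⟩)
  have hVz : f z < s * f a + (1 - s) * f b :=
    hlt.trans_le (hmax' x y t hx.1 hxz hzy hy.2 ht.1 ht.2 hz)
  have haz' : a < z := by
    refine lt_of_le_of_ne haz fun h => ?_
    subst h
    have h0 : (1 - s) * (b - a) = 0 := by linarith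
    rcases mul_eq_zero.1 h0 with h | h
    · have : s = 1 := by linarith
      subst this; simp at hVz
    · have : b = a := by linarith
      subst this; linarith
  have hzb' : z < b := by
    refine lt_of_le_of_ne hzb fun h => ?_
    subst h
    have h0 : s * (z - a) = 0 := by linarith
    rcases mul_eq_zero.1 h0 with h | h
    · subst h; simp at hVz
    · linarith
  have hab : 0 < b - a := by linarith
  obtain ⟨m, hm⟩ : ∃ m, f b = f a + m * (b - a) :=
    ⟨(f b - f a) / (b - a), by field_simp; ring⟩
  have hV : s * f a + (1 - s) * f b = f a + m * (z - a) := by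
    rw [hm, ← hsz]; ring
  rw [hV] at hVz hmax'
  refine ⟨a, b, z, m, ha0, haz', hzb', hb1, hVz, hm, fun c hc => ?_⟩
  rcases lt_trichotomy c z with hcz | rfl | hcz
  · have hbc : 0 < b - c := by linarith
    have h := hmax' c b ((b - z) / (b - c)) hc.1 hcz.le hzb hb1
      (div_nonneg (by linarith) hbc.le) ((div_le_one hbc).2 (by linarith))
      (by field_simp; ring)
    have e : (b - z) / (b - c) * f c + (1 - (b - z) / (b - c)) * f b
        = ((b - z) * f c + (z - c) * f b) / (b - c) := by field_simp; ring
    rw [e, div_le_iff₀ hbc, hm] at h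
    refine le_of_mul_le_mul_left (?_ : (b - z) * f c ≤ _) (by linarith : 0 < b - z)
    linarith
  · exact hVz.le
  · have hca : 0 < c - a := by linarith
    have h := hmax' a c ((c - z) / (c - a)) ha0 haz hcz.le hc.2
      (div_nonneg (by linarith) hca.le) ((div_le_one hca).2 (by linarith))
      (by field_simp; ring)
    have e : (c - z) / (c - a) * f a + (1 - (c - z) / (c - a)) * f c
        = ((c - z) * f a + (z - a) * f c) / (c - a) := by field_simp; ring
    rw [e, div_le_iff₀ hca] at h
    refine le_of_mul_le_mul_left (?_ : (z - a) * f c ≤ _) (by linarith : 0 < z - a)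
    linarith

theorem intervalIntegrable_of_Icc {g : ℝ → ℝ} (hg : IntegrableOn g (Icc (0:ℝ) 1)) {s t : ℝ}
    (hs : s ∈ Icc (0:ℝ) 1) (ht : t ∈ Icc (0:ℝ) 1) : IntervalIntegrable g volume s t :=
  (hg.mono_set (ordConnected_Icc.uIcc_subset hs ht)).intervalIntegrable

theorem integral_eq_sub_of_primitive {f g : ℝ → ℝ} (hg : IntegrableOn g (Icc (0:ℝ) 1))
    (hf : ∀ x ∈ Icc (0:ℝ) 1, f x = f 0 + ∫ r in (0:ℝ)..x, g r) {s t : ℝ}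
    (hs : s ∈ Icc (0:ℝ) 1) (ht : t ∈ Icc (0:ℝ) 1) : ∫ r in s..t, g r = f t - f s := by
  have h0 : (0:ℝ) ∈ Icc (0:ℝ) 1 := ⟨le_rfl, zero_le_one⟩
  rw [hf t ht, hf s hs, ← intervalIntegral.integral_add_adjacent_intervals
    (intervalIntegrable_of_Icc hg h0 hs) (intervalIntegrable_of_Icc hg hs ht)]
  ring

theorem continuousOn_of_primitive {f g : ℝ → ℝ} (hg : IntegrableOn g (Icc (0:ℝ) 1))
    (hf : ∀ x ∈ Icc (0:ℝ) 1, f x = f 0 + ∫ r in (0:ℝ)..x, g r) :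
    ContinuousOn f (Icc (0:ℝ) 1) := by
  have h := intervalIntegral.continuousOn_primitive_interval (μ := volume) (f := g)
    (a := 0) (b := 1) (by rwa [uIcc_of_le zero_le_one])
  rw [uIcc_of_le zero_le_one] at h
  exact (continuousOn_const.add h).congr hf

open Classical in
/-- Replacing a primitive by an affine function on `[a, b]`, provided the values match at those
endpoints which are interior to `[0, 1]`, yields a primitive of the replaced derivative. -/
theorem primitive_piecewise_affine {f g : ℝ → ℝ} (hg : IntegrableOn g (Icc (0:ℝ) 1))
    (hf : ∀ x ∈ Icc (0:ℝ) 1, f x = f 0 + ∫ r in (0:ℝ)..x, g r) {a b m p : ℝ}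
    (ha0 : 0 ≤ a) (hab : a < b) (hb1 : b ≤ 1)
    (ha : 0 < a → f a = p) (hb : b < 1 → f b = p + m * (b - a)) :
    ∀ x ∈ Icc (0:ℝ) 1, (Icc a b).piecewise (fun x => p + m * (x - a)) f x =
      (Icc a b).piecewise (fun x => p + m * (x - a)) f 0 +
        ∫ r in (0:ℝ)..x, (Icc a b).piecewise (fun _ => m) g r := by
  have h0 : (0:ℝ) ∈ Icc (0:ℝ) 1 := ⟨le_rfl, zero_le_one⟩
  have hG : IntegrableOn ((Icc a b).piecewise (fun _ => m) g) (Icc (0:ℝ) 1) :=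
    Integrable.piecewise measurableSet_Icc
      (integrableOn_const (measure_ne_top _ _)) hg.integrable.integrableOn
  have hF : ∀ x ∈ Icc a b, (Icc a b).piecewise (fun x => p + m * (x - a)) f x = p + m * (x - a) :=
    fun x hx => if_pos hx
  have hF' : ∀ x ∉ Icc a b, (Icc a b).piecewise (fun x => p + m * (x - a)) f x = f x :=
    fun x hx => if_neg hx
  have hleft : ∀ x, 0 ≤ x → x ≤ a →
      ∫ r in (0:ℝ)..x, (Icc a b).piecewise (fun _ => m) g r = f x - f 0 := by
    intro x hx hxa
    rw [← integral_eq_sub_of_primitive hg hf h0 ⟨hx, by linarith⟩]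
    refine intervalIntegral.integral_congr_Ioo_of_le hx fun r hr => ?_
    exact piecewise_eq_of_notMem _ _ _ fun h => absurd h.1 (by linarith [hr.2])
  have hmid : ∀ x, a ≤ x → x ≤ b →
      ∫ r in a..x, (Icc a b).piecewise (fun _ => m) g r = m * (x - a) := by
    intro x hx hxb
    rw [intervalIntegral.integral_congr (g := fun _ => m)]
    · simp [mul_comm]
    · intro r hr
      rw [uIcc_of_le hx] at hr
      exact piecewise_eq_of_mem _ _ _ ⟨hr.1, hr.2.trans hxb⟩
  have hright : ∀ x, b ≤ x → x ≤ 1 →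
      ∫ r in b..x, (Icc a b).piecewise (fun _ => m) g r = f x - f b := by
    intro x hx hx1
    rw [← integral_eq_sub_of_primitive hg hf ⟨by linarith, hb1⟩ ⟨by linarith, hx1⟩]
    refine intervalIntegral.integral_congr_Ioo_of_le hx fun r hr => ?_
    exact piecewise_eq_of_notMem _ _ _ fun h => absurd h.2 (by linarith [hr.1])
  have hint : ∀ {s t : ℝ}, s ∈ Icc (0:ℝ) 1 → t ∈ Icc (0:ℝ) 1 →
      IntervalIntegrable ((Icc a b).piecewise (fun _ => m) g) volume s t :=
    fun hs ht => intervalIntegrable_of_Icc hG hs ht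
  have hI : ∀ x, a ≤ x → x ≤ b → p + m * (x - a) =
      (Icc a b).piecewise (fun x => p + m * (x - a)) f 0 +
        ∫ r in (0:ℝ)..x, (Icc a b).piecewise (fun _ => m) g r := by
    intro x hx hxb
    rw [← intervalIntegral.integral_add_adjacent_intervals (hint h0 ⟨ha0, by linarith⟩)
      (hint ⟨ha0, by linarith⟩ ⟨by linarith, by linarith⟩), hmid x hx hxb, hleft a ha0 le_rfl]
    rcases ha0.eq_or_lt with h | h
    · subst h
      rw [hF 0 ⟨le_rfl, hab.le⟩]
      ring
    · rw [hF' 0 (fun h' => absurd h'.1 (by linarith)), ha h]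
      ring
  intro x hx
  rcases lt_or_ge x a with hxa | hxa
  · rw [hleft x hx.1 hxa.le, hF' x (fun h' => absurd h'.1 (by linarith)),
      hF' 0 (fun h' => absurd h'.1 (by linarith [hx.1]))]
    ring
  rcases le_or_gt x b with hxb | hxb
  · rw [hF x ⟨hxa, hxb⟩]
    exact hI x hxa hxb
  · have h := hI b hab.le le_rfl
    rw [← hb (hxb.trans_le hx.2)] at h
    rw [← intervalIntegral.integral_add_adjacent_intervals (hint h0 ⟨by linarith, hb1⟩)
      (hint ⟨by linarith, hb1⟩ hx), hright x hxb.le hx.2,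
      hF' x (fun h' => absurd h'.2 (by linarith))]
    linarith

theorem W22.hasDerivAt (f : W22) {x : ℝ} (hx : x ∈ Ioo (0:ℝ) 1) : HasDerivAt f.u (f.du x) x := by
  have hn : Icc (0:ℝ) 1 ∈ 𝓝 x := Icc_mem_nhds hx.1 hx.2
  have hc : ContinuousOn f.du (Icc (0:ℝ) 1) := continuousOn_of_primitive f.ddu_int f.ftc_du
  have h := intervalIntegral.integral_hasDerivAt_right
    (intervalIntegrable_of_Icc f.du_int ⟨le_rfl, zero_le_one⟩ (Ioo_subset_Icc_self hx))
    ((hc.mono Ioo_subset_Icc_self).stronglyMeasurableAtFilter isOpen_Ioo x hx)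
    (hc.continuousAt hn)
  exact (h.const_add (f.u 0)).congr_of_eventuallyEq (Filter.eventually_of_mem hn f.ftc_u)

theorem W22.integrableOn_graphE (f : W22) :
    IntegrableOn (fun x => (f.ddu x)^2 / (1 + (f.du x)^2) ^ ((5:ℝ)/2)) (Ioo (0:ℝ) 1) := by
  have hsq := f.ddu_sq.mono_set Ioo_subset_Icc_self
  have hdu := (f.du_int.mono_set Ioo_subset_Icc_self).aemeasurable
  refine Integrable.mono' hsq ?_ (ae_of_all _ fun x => ?_)
  · exact (hsq.aemeasurable.div
      (((hdu.pow_const 2).const_add 1).pow_const _)).aestronglyMeasurable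
  · have h1 : 1 ≤ (1 + (f.du x)^2) ^ ((5:ℝ)/2) :=
      Real.one_le_rpow (by nlinarith [sq_nonneg (f.du x)]) (by norm_num)
    rw [Real.norm_of_nonneg (div_nonneg (sq_nonneg _) (by linarith))]
    exact div_le_self (sq_nonneg _) h1

theorem W22.integrableOn_graphLen (f : W22) :
    IntegrableOn (fun x => Real.sqrt (1 + (f.du x)^2)) (Ioo (0:ℝ) 1) := by
  have hdu := f.du_int.mono_set (Ioo_subset_Icc_self (a := (0:ℝ)) (b := 1))
  have h1 : IntegrableOn (fun x => 1 + |f.du x|) (Ioo (0:ℝ) 1) :=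
    (integrableOn_const (by simp)).add hdu.abs
  refine Integrable.mono' h1 ?_ (ae_of_all _ fun x => ?_)
  · exact ((hdu.aemeasurable.pow_const 2).const_add 1).sqrt.aestronglyMeasurable
  · rw [Real.norm_of_nonneg (Real.sqrt_nonneg _)]
    refine Real.sqrt_le_iff.2 ⟨by positivity, ?_⟩
    nlinarith [abs_nonneg (f.du x), sq_abs (f.du x)]

theorem sqrt_one_add_sq_tangent_le (m p : ℝ) :
    Real.sqrt (1 + m^2) + m / Real.sqrt (1 + m^2) * (p - m) ≤ Real.sqrt (1 + p^2) := by
  have hm : 0 < Real.sqrt (1 + m^2) := Real.sqrt_pos.2 (by positivity)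
  have hms : Real.sqrt (1 + m^2) ^ 2 = 1 + m^2 := Real.sq_sqrt (by positivity)
  have e : Real.sqrt (1 + m^2) + m / Real.sqrt (1 + m^2) * (p - m)
      = (1 + m * p) / Real.sqrt (1 + m^2) := by
    field_simp
    rw [hms]; ring
  rw [e, div_le_iff₀ hm, ← Real.sqrt_mul (by positivity)]
  exact Real.le_sqrt_of_sq_le (by nlinarith [sq_nonneg (m - p)])

open Classical in
/-- The function obtained from `f` by replacing it on `[a, b]` by the affine function of slope `m`
through `(a, f a)`. -/
def W22.flatten (f : W22) {a b m : ℝ} (ha0 : 0 ≤ a) (hab : a < b) (hb1 : b ≤ 1)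
    (hfb : f.u b = f.u a + m * (b - a)) (ha : 0 < a → f.du a = m) (hb : b < 1 → f.du b = m) :
    W22 where
  u := (Icc a b).piecewise (fun x => f.u a + m * (x - a)) f.u
  du := (Icc a b).piecewise (fun _ => m) f.du
  ddu := (Icc a b).piecewise (fun _ => 0) f.ddu
  du_int := Integrable.piecewise measurableSet_Icc
    (integrableOn_const (measure_ne_top _ _)) f.du_int.integrableOn
  ddu_int := Integrable.piecewise measurableSet_Icc integrableOn_zero f.ddu_int.integrableOn
  ddu_sq := by
    have : (fun x => ((Icc a b).piecewise (fun _ => 0) f.ddu x)^2)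
        = (Icc a b).piecewise (fun _ => (0:ℝ)) (fun x => (f.ddu x)^2) := by
      ext x
      by_cases hx : x ∈ Icc a b <;> simp [piecewise, hx]
    rw [this]
    exact Integrable.piecewise measurableSet_Icc integrableOn_zero f.ddu_sq.integrableOn
  ftc_u := primitive_piecewise_affine f.du_int f.ftc_u ha0 hab hb1 (fun _ => rfl) (fun _ => hfb)
  ftc_du := by
    have h := primitive_piecewise_affine (m := 0) (p := m) f.ddu_int f.ftc_du ha0 hab hb1 ha
      (fun h => by rw [hb h]; ring)
    simpa only [zero_mul, add_zero] using h

/-- A minimizer of the penalized energy in `G_ψ` is concave. -/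
theorem stmt8 (ψ : ℝ → ℝ) (hψ : Admissible ψ) (ε : ℝ) (hε : 0 ≤ ε) (u : W22)
    (hu : MemG ψ u) (hmin : ∀ v : W22, MemG ψ v → graphPE ε u ≤ graphPE ε v) :
    ConcaveOn ℝ (Icc (0:ℝ) 1) u.u := by
  by_contra hnc
  obtain ⟨a, b, z, m, ha0, haz, hzb, hb1, hz, hub, hle⟩ :=
    exists_supporting_chord (continuousOn_of_primitive u.du_int u.ftc_u) hnc
  have hab : a < b := haz.trans hzb
  have htouch : ∀ c ∈ Ioo (0:ℝ) 1, u.u c = u.u a + m * (c - a) → u.du c = m := by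
    intro c hc hcu
    have hd : HasDerivAt (fun x => u.u x - (u.u a + m * (x - a))) (u.du c - m) c := by
      have h := (((hasDerivAt_id c).sub_const a).const_mul m).const_add (u.u a)
      rw [mul_one] at h
      exact (u.hasDerivAt hc).sub h
    have hmax : IsLocalMax (fun x => u.u x - (u.u a + m * (x - a))) c := by
      filter_upwards [Icc_mem_nhds hc.1 hc.2] with x hx
      have := hle x hx
      linarith
    linarith [hmax.hasDerivAt_eq_zero hd]
  have hda : 0 < a → u.du a = m := fun h => htouch a ⟨h, by linarith⟩ (by ring)
  have hdb : b < 1 → u.du b = m := fun h => htouch b ⟨by linarith, h⟩ hub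
  set v := u.flatten ha0 hab hb1 hub hda hdb
  have hvu : ∀ x ∈ Icc a b, v.u x = u.u a + m * (x - a) :=
    fun x hx => if_pos hx
  have hvu' : ∀ x ∉ Icc a b, v.u x = u.u x := fun x hx => if_neg hx
  have hvd : ∀ x ∈ Icc a b, v.du x = m := fun x hx => if_pos hx
  have hvd' : ∀ x ∉ Icc a b, v.du x = u.du x := fun x hx => if_neg hx
  have hvdd : ∀ x ∈ Icc a b, v.ddu x = 0 := fun x hx => if_pos hx
  have hvdd' : ∀ x ∉ Icc a b, v.ddu x = u.ddu x := fun x hx => if_neg hx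
  have hvG : MemG ψ v := by
    refine ⟨?_, ?_, fun x hx => (hu.2.2 x hx).trans ?_⟩
    · by_cases h : (0:ℝ) ∈ Icc a b
      · have : a = 0 := le_antisymm h.1 ha0
        rw [hvu 0 h, this, hu.1]; ring
      · rw [hvu' 0 h, hu.1]
    · by_cases h : (1:ℝ) ∈ Icc a b
      · have : b = 1 := le_antisymm hb1 h.2
        rw [hvu 1 h, ← this, ← hub, this, hu.2.1]
      · rw [hvu' 1 h, hu.2.1]
    · by_cases h : x ∈ Icc a b
      · rw [hvu x h]; exact hle x hx
      · rw [hvu' x h]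
  have hmemA : a ∈ Icc (0:ℝ) 1 := ⟨ha0, by linarith⟩
  have hmemB : b ∈ Icc (0:ℝ) 1 := ⟨by linarith, hb1⟩
  have hIoo : Ioo a b ⊆ Ioo (0:ℝ) 1 := Ioo_subset_Ioo ha0 hb1
  have hlen : graphLen v ≤ graphLen u := by
    set k := m / Real.sqrt (1 + m^2)
    have hdiff : IntegrableOn (fun x => k * (u.du x - v.du x)) (Ioo (0:ℝ) 1) :=
      ((u.du_int.mono_set Ioo_subset_Icc_self).sub
        (v.du_int.mono_set Ioo_subset_Icc_self)).const_mul k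
    have hzero : ∫ x in Ioo (0:ℝ) 1, k * (u.du x - v.du x) = 0 := by
      have h0 : (0:ℝ) ∈ Icc (0:ℝ) 1 := ⟨le_rfl, zero_le_one⟩
      have h1 : (1:ℝ) ∈ Icc (0:ℝ) 1 := ⟨zero_le_one, le_rfl⟩
      rw [← integral_Ioc_eq_integral_Ioo, ← intervalIntegral.integral_of_le zero_le_one,
        intervalIntegral.integral_const_mul, intervalIntegral.integral_sub
          (intervalIntegrable_of_Icc u.du_int h0 h1) (intervalIntegrable_of_Icc v.du_int h0 h1),
        integral_eq_sub_of_primitive u.du_int u.ftc_u h0 h1,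
        integral_eq_sub_of_primitive v.du_int v.ftc_u h0 h1, hu.1, hu.2.1, hvG.1, hvG.2.1]
      ring
    have h : ∫ x in Ioo (0:ℝ) 1, (Real.sqrt (1 + (v.du x)^2) + k * (u.du x - v.du x)) ≤
        graphLen u := by
      refine setIntegral_mono (v.integrableOn_graphLen.add hdiff) u.integrableOn_graphLen
        fun x => ?_
      by_cases hx : x ∈ Icc a b
      · simp only [hvd x hx]
        exact sqrt_one_add_sq_tangent_le m (u.du x)
      · simp [hvd' x hx]
    rwa [integral_add v.integrableOn_graphLen hdiff, hzero, add_zero] at h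
  have hE : graphE u ≤ graphE v := by
    have h := hmin v hvG
    unfold graphPE at h
    nlinarith [mul_le_mul_of_nonneg_left hlen hε]
  have hdd : ∀ᵐ x ∂volume.restrict (Ioo (0:ℝ) 1), x ∈ Icc a b → u.ddu x = 0 := by
    have hnn : ∀ x, 0 ≤ (u.ddu x)^2 / (1 + (u.du x)^2) ^ ((5:ℝ)/2) -
        (v.ddu x)^2 / (1 + (v.du x)^2) ^ ((5:ℝ)/2) := by
      intro x
      by_cases hx : x ∈ Icc a b
      · rw [hvdd x hx]
        have : 0 ≤ (u.ddu x)^2 / (1 + (u.du x)^2) ^ ((5:ℝ)/2) := by positivity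
        simpa using this
      · rw [hvdd' x hx, hvd' x hx, sub_self]
    have hint := u.integrableOn_graphE.sub v.integrableOn_graphE
    have hI0 : ∫ x in Ioo (0:ℝ) 1, ((u.ddu x)^2 / (1 + (u.du x)^2) ^ ((5:ℝ)/2) -
        (v.ddu x)^2 / (1 + (v.du x)^2) ^ ((5:ℝ)/2)) = 0 := by
      refine le_antisymm ?_ (integral_nonneg hnn)
      rw [integral_sub u.integrableOn_graphE v.integrableOn_graphE]
      exact sub_nonpos.2 hE
    filter_upwards [(integral_eq_zero_iff_of_nonneg hnn hint).1 hI0] with x hx hxab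
    have hpos : 0 < (1 + (u.du x)^2) ^ ((5:ℝ)/2) := by positivity
    simp only [hvdd x hxab, Pi.zero_apply] at hx
    simpa [hpos.ne'] using hx
  have hconst : ∀ x ∈ Icc a b, u.du x = u.du a := by
    intro x hx
    have hxI : x ∈ Icc (0:ℝ) 1 := ⟨ha0.trans hx.1, hx.2.trans hb1⟩
    have h := integral_eq_sub_of_primitive u.ddu_int u.ftc_du hmemA hxI
    rw [intervalIntegral.integral_of_le hx.1, integral_Ioc_eq_integral_Ioo,
      integral_eq_zero_of_ae] at h
    · linarith
    · have hsub : Ioo a x ⊆ Ioo a b := Ioo_subset_Ioo_right hx.2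
      filter_upwards [ae_restrict_of_ae_restrict_of_subset (hsub.trans hIoo) hdd,
        ae_restrict_mem measurableSet_Ioo] with y hy hyx
      exact hy (Ioo_subset_Icc_self (hsub hyx))
  have haff : ∀ x ∈ Icc a b, u.u x = u.u a + u.du a * (x - a) := by
    intro x hx
    have hxI : x ∈ Icc (0:ℝ) 1 := ⟨ha0.trans hx.1, hx.2.trans hb1⟩
    have h := integral_eq_sub_of_primitive u.du_int u.ftc_u hmemA hxI
    rw [intervalIntegral.integral_congr (g := fun _ => u.du a)] at h
    · simp only [intervalIntegral.integral_const, smul_eq_mul] at h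
      linarith
    · intro y hy
      rw [uIcc_of_le hx.1] at hy
      exact hconst y ⟨hy.1, hy.2.trans hx.2⟩
  have hslope : u.du a = m := by
    have h := haff b ⟨hab.le, le_rfl⟩
    rw [hub] at h
    exact (mul_right_cancel₀ (sub_ne_zero.2 hab.ne') (add_left_cancel h)).symm
  have h := haff z ⟨haz.le, hzb.le⟩
  rw [hslope] at h
  exact hz.ne h
end
end

section
/- Let ψ be an admissible obstacle, ε ≥ 0, and let u ∈ G_ψ satisfy E_ε(u) = inf_{w ∈ G_ψ} E_ε(w). Then u touches the obstacle: there exists x₀ ∈ (0,1) with u(x₀) = ψ(x₀). -/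
open MeasureTheory Set Topology Filter

noncomputable section

lemma AbsolutelyContinuousOnInterval.of_dist_le {f g : ℝ → ℝ} {a b : ℝ}
    (hf : AbsolutelyContinuousOnInterval f a b)
    (h : ∀ x ∈ uIcc a b, ∀ y ∈ uIcc a b, dist (g x) (g y) ≤ dist (f x) (f y)) :
    AbsolutelyContinuousOnInterval g a b := by
  rw [absolutelyContinuousOnInterval_iff] at hf ⊢
  intro ε hε
  obtain ⟨δ, hδ, H⟩ := hf ε hε
  refine ⟨δ, hδ, fun E hE hlen => lt_of_le_of_lt (Finset.sum_le_sum fun i hi => ?_) (H E hE hlen)⟩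
  exact h _ (hE.1 i hi).1 _ (hE.1 i hi).2

/-- Truncation of a real number to the interval `[l, h]`. -/
def clamp (l h p : ℝ) : ℝ := max l (min h p)

lemma dist_clamp_le (l h p q : ℝ) : dist (clamp l h p) (clamp l h q) ≤ dist p q := by
  simp only [clamp, Real.dist_eq]
  refine (abs_max_sub_max_le_max _ _ _ _).trans ?_
  refine max_le (by simp) ((abs_min_sub_min_le_max _ _ _ _).trans ?_)
  simp

lemma le_clamp (l h p : ℝ) : l ≤ clamp l h p := le_max_left _ _

lemma clamp_le {l h : ℝ} (hlh : l ≤ h) (p : ℝ) : clamp l h p ≤ h :=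
  max_le hlh (min_le_left _ _)

lemma clamp_of_mem {l h p : ℝ} (hp : p ∈ Icc l h) : clamp l h p = p := by
  rw [clamp, min_eq_right hp.2, max_eq_right hp.1]

lemma clamp_of_ge {l h p : ℝ} (hlh : l ≤ h) (hp : h ≤ p) : clamp l h p = h := by
  rw [clamp, min_eq_left hp, max_eq_right hlh]

lemma clamp_of_le {l h p : ℝ} (hp : p ≤ l) : clamp l h p = l :=
  max_eq_left ((min_le_right _ _).trans hp)

lemma continuous_clamp (l h : ℝ) : Continuous (clamp l h) := by
  unfold clamp; fun_prop

lemma clamp_eq_sub_add {l h : ℝ} (hlh : l ≤ h) (p : ℝ) :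
    clamp l h p = p - max (p - h) 0 + max (l - p) 0 := by
  rcases le_total p l with hp | hp
  · rw [clamp_of_le hp, max_eq_right (by linarith), max_eq_left (by linarith)]; ring
  rcases le_total p h with hp' | hp'
  · rw [clamp_of_mem ⟨hp, hp'⟩, max_eq_right (by linarith), max_eq_right (by linarith)]; ring
  · rw [clamp_of_ge hlh hp', max_eq_left (by linarith), max_eq_right (by linarith)]; ring

lemma sq_clamp_le {l h : ℝ} (hl : l ≤ 0) (hh : 0 ≤ h) (p : ℝ) : clamp l h p ^ 2 ≤ p ^ 2 := by
  have := dist_clamp_le l h p 0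
  rw [clamp_of_mem (p := 0) ⟨hl, hh⟩, Real.dist_eq, Real.dist_eq, sub_zero, sub_zero] at this
  exact sq_le_sq.2 this

lemma deriv_clamp_comp {l h : ℝ} (hlh : l ≤ h) {p : ℝ → ℝ} {d x : ℝ} (hp : HasDerivAt p d x) :
    deriv (fun y => clamp l h (p y)) x = if p x ∈ Ioo l h then d else 0 := by
  split_ifs with hx
  · have hev : (fun y => clamp l h (p y)) =ᶠ[𝓝 x] p := by
      filter_upwards [hp.continuousAt.eventually_mem (isOpen_Ioo.mem_nhds hx)] with y hy
      exact clamp_of_mem (Ioo_subset_Icc_self hy)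
    rw [hev.deriv_eq, hp.deriv]
  · rcases le_or_gt (p x) l with hl | hl
    · refine IsLocalMin.deriv_eq_zero (Eventually.of_forall fun y => ?_)
      simp only [clamp_of_le hl]
      exact le_clamp _ _ _
    · have hh : h ≤ p x := by
        by_contra hc
        exact hx ⟨hl, not_le.1 hc⟩
      refine IsLocalMax.deriv_eq_zero (Eventually.of_forall fun y => ?_)
      simp only [clamp_of_ge hlh hh]
      exact clamp_le hlh _

lemma intervalIntegrable_of_integrableOn_Icc {f : ℝ → ℝ} (hf : IntegrableOn f (Icc (0:ℝ) 1)) :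
    IntervalIntegrable f volume 0 1 :=
  (intervalIntegrable_iff_integrableOn_Icc_of_le zero_le_one).2 hf

namespace W22

variable (f : W22)

lemma ac_du : AbsolutelyContinuousOnInterval f.du 0 1 := by
  have h := (intervalIntegrable_of_integrableOn_Icc
    f.ddu_int).absolutelyContinuousOnInterval_intervalIntegral (c := 0) (by simp)
  refine h.of_dist_le fun x hx y hy => ?_
  rw [uIcc_of_le zero_le_one] at hx hy
  rw [f.ftc_du x hx, f.ftc_du y hy, dist_add_left]

lemma ac_u : AbsolutelyContinuousOnInterval f.u 0 1 := by
  have h := (intervalIntegrable_of_integrableOn_Icc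
    f.du_int).absolutelyContinuousOnInterval_intervalIntegral (c := 0) (by simp)
  refine h.of_dist_le fun x hx y hy => ?_
  rw [uIcc_of_le zero_le_one] at hx hy
  rw [f.ftc_u x hx, f.ftc_u y hy, dist_add_left]

lemma continuousOn_du : ContinuousOn f.du (Icc 0 1) := by
  simpa [uIcc_of_le] using f.ac_du.continuousOn

lemma continuousOn_u : ContinuousOn f.u (Icc 0 1) := by
  simpa [uIcc_of_le] using f.ac_u.continuousOn

lemma ae_hasDerivAt_du : ∀ᵐ x, x ∈ Ioo (0:ℝ) 1 → HasDerivAt f.du (f.ddu x) x := by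
  filter_upwards [(intervalIntegrable_of_integrableOn_Icc f.ddu_int).ae_hasDerivAt_integral]
    with x hx hx01
  have h := (hx (by rw [uIcc_of_le zero_le_one]; exact Ioo_subset_Icc_self hx01) 0
    (by simp)).const_add (f.du 0)
  refine h.congr_of_eventuallyEq ?_
  filter_upwards [isOpen_Ioo.mem_nhds hx01] with y hy
  exact f.ftc_du y (Ioo_subset_Icc_self hy)

lemma ae_deriv_clamp_du {l h : ℝ} (hlh : l ≤ h) :
    ∀ᵐ x ∂(volume.restrict (Ioo (0:ℝ) 1)),
      deriv (fun y => clamp l h (f.du y)) x = if f.du x ∈ Ioo l h then f.ddu x else 0 := by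
  rw [ae_restrict_iff' measurableSet_Ioo]
  filter_upwards [f.ae_hasDerivAt_du] with x hx hx01
  exact deriv_clamp_comp hlh (hx hx01)

lemma ac_clamp_du (l h : ℝ) :
    AbsolutelyContinuousOnInterval (fun y => clamp l h (f.du y)) 0 1 :=
  f.ac_du.of_dist_le fun _ _ _ _ => dist_clamp_le _ _ _ _

/-- The function vanishing at `0` whose slope is the truncation of the slope of `f`
to `[l, h]`. -/
def truncate {l h : ℝ} (hlh : l ≤ h) : W22 where
  u x := ∫ s in (0:ℝ)..x, clamp l h (f.du s)
  du x := clamp l h (f.du x)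
  ddu := deriv fun y => clamp l h (f.du y)
  du_int := ((continuous_clamp l h).comp_continuousOn f.continuousOn_du).integrableOn_Icc
  ddu_int := (intervalIntegrable_iff_integrableOn_Icc_of_le zero_le_one).1
    (f.ac_clamp_du l h).intervalIntegrable_deriv
  ddu_sq := by
    rw [integrableOn_Icc_iff_integrableOn_Ioo]
    refine Integrable.mono' (f.ddu_sq.mono_set Ioo_subset_Icc_self)
      ((measurable_deriv _).pow_const 2).aestronglyMeasurable ?_
    filter_upwards [f.ae_deriv_clamp_du hlh] with x hx
    rw [hx, Real.norm_of_nonneg (sq_nonneg _)]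
    split_ifs
    · exact le_rfl
    · simpa using sq_nonneg (f.ddu x)
  ftc_u x _ := by simp
  ftc_du x hx := by
    have := ((f.ac_clamp_du l h).mono (c := 0) (d := x) (by
      rw [uIcc_of_le hx.1, uIcc_of_le zero_le_one]
      exact Icc_subset_Icc_right hx.2)).integral_deriv_eq_sub
    rw [this]; ring

lemma integrableOn_graphE_s9 :
    IntegrableOn (fun x => (f.ddu x)^2 / (1 + (f.du x)^2) ^ ((5:ℝ)/2)) (Ioo (0:ℝ) 1) := by
  have h1 := (f.ddu_int.mono_set Ioo_subset_Icc_self).aestronglyMeasurable.aemeasurable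
  have h2 := (f.du_int.mono_set Ioo_subset_Icc_self).aestronglyMeasurable.aemeasurable
  refine Integrable.mono' (f.ddu_sq.mono_set Ioo_subset_Icc_self)
    ((h1.pow_const 2).div (((h2.pow_const 2).const_add 1).pow_const _)).aestronglyMeasurable
    (Eventually.of_forall fun x => ?_)
  rw [Real.norm_of_nonneg (by positivity)]
  exact div_le_self (sq_nonneg _)
    (Real.one_le_rpow (by nlinarith [sq_nonneg (f.du x)]) (by norm_num))

lemma integrableOn_graphLen_s9 :
    IntegrableOn (fun x => Real.sqrt (1 + (f.du x)^2)) (Ioo (0:ℝ) 1) := by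
  have : ContinuousOn (fun x => Real.sqrt (1 + (f.du x)^2)) (Icc (0:ℝ) 1) :=
    (continuousOn_const.add (f.continuousOn_du.pow 2)).sqrt
  exact this.integrableOn_Icc.mono_set Ioo_subset_Icc_self

lemma graphLen_truncate_le {l h : ℝ} (hl : l ≤ 0) (hh : 0 ≤ h) :
    graphLen (f.truncate (hl.trans hh)) ≤ graphLen f := by
  refine integral_mono (integrableOn_graphLen_s9 _) f.integrableOn_graphLen_s9 fun x => ?_
  exact Real.sqrt_le_sqrt (by gcongr 1 + ?_; exact sq_clamp_le hl hh (f.du x))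

lemma ae_graphE_truncate {l h : ℝ} (hlh : l ≤ h) :
    ∀ᵐ x ∂(volume.restrict (Ioo (0:ℝ) 1)),
      ((f.truncate hlh).ddu x)^2 / (1 + ((f.truncate hlh).du x)^2) ^ ((5:ℝ)/2) =
        if f.du x ∈ Ioo l h then (f.ddu x)^2 / (1 + (f.du x)^2) ^ ((5:ℝ)/2) else 0 := by
  filter_upwards [f.ae_deriv_clamp_du hlh] with x hx
  simp only [truncate, hx]
  split_ifs with hmem
  · rw [clamp_of_mem (Ioo_subset_Icc_self hmem)]
  · simp

lemma graphE_truncate_le {l h : ℝ} (hlh : l ≤ h) : graphE (f.truncate hlh) ≤ graphE f := by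
  refine integral_mono_ae (integrableOn_graphE_s9 _) f.integrableOn_graphE_s9 ?_
  filter_upwards [f.ae_graphE_truncate hlh] with x hx
  simp only [hx]
  split_ifs
  · exact le_rfl
  · positivity

/-- If truncating the slope does not decrease the elastic energy, then the second derivative is
unchanged. -/
lemma ae_ddu_eq_of_graphE_le {l h : ℝ} (hlh : l ≤ h) (hE : graphE f ≤ graphE (f.truncate hlh)) :
    ∀ᵐ x ∂(volume.restrict (Ioo (0:ℝ) 1)), (f.truncate hlh).ddu x = f.ddu x := by
  have heq : graphE (f.truncate hlh) = graphE f := le_antisymm (f.graphE_truncate_le hlh) hE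
  have hle : (fun x => ((f.truncate hlh).ddu x)^2 /
      (1 + ((f.truncate hlh).du x)^2) ^ ((5:ℝ)/2)) ≤ᵐ[volume.restrict (Ioo (0:ℝ) 1)]
      fun x => (f.ddu x)^2 / (1 + (f.du x)^2) ^ ((5:ℝ)/2) := by
    filter_upwards [f.ae_graphE_truncate hlh] with x hx
    rw [hx]
    split_ifs
    · exact le_rfl
    · positivity
  have hae := (integral_eq_iff_of_ae_le (integrableOn_graphE_s9 _) f.integrableOn_graphE_s9 hle).1 heq
  filter_upwards [hae, f.ae_graphE_truncate hlh, f.ae_deriv_clamp_du hlh] with x h1 h2 h3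
  change deriv _ x = _
  rw [h3]
  split_ifs with hmem
  · rfl
  · rw [h2, if_neg hmem, eq_comm, div_eq_zero_iff] at h1
    have : (0:ℝ) < (1 + (f.du x)^2) ^ ((5:ℝ)/2) := by positivity
    rcases h1 with h1 | h1
    · exact (pow_eq_zero_iff two_ne_zero).1 h1 |>.symm
    · exact absurd h1 this.ne'

/-- Functions with the same second derivative and the same boundary values have the same slope. -/
lemma du_eq_of_ddu_eq {f g : W22}
    (h : ∀ᵐ x ∂(volume.restrict (Ioo (0:ℝ) 1)), f.ddu x = g.ddu x)
    (h0 : f.u 0 = g.u 0) (h1 : f.u 1 = g.u 1) {x : ℝ} (hx : x ∈ Icc (0:ℝ) 1) :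
    f.du x = g.du x := by
  have key : ∀ y ∈ Icc (0:ℝ) 1, f.du y = g.du y + (f.du 0 - g.du 0) := by
    intro y hy
    have : ∫ s in (0:ℝ)..y, f.ddu s = ∫ s in (0:ℝ)..y, g.ddu s := by
      rw [intervalIntegral.integral_of_le hy.1, intervalIntegral.integral_of_le hy.1,
        integral_Ioc_eq_integral_Ioo, integral_Ioc_eq_integral_Ioo]
      exact integral_congr_ae (ae_restrict_of_ae_restrict_of_subset
        (Ioo_subset_Ioo_right hy.2) h)
    rw [f.ftc_du y hy, g.ftc_du y hy, this]; ring
  have hint : ∫ s in (0:ℝ)..1, f.du s = (∫ s in (0:ℝ)..1, g.du s) + (f.du 0 - g.du 0) := by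
    rw [intervalIntegral.integral_congr (g := fun s => g.du s + (f.du 0 - g.du 0)) (by
      intro y hy
      rw [uIcc_of_le zero_le_one] at hy
      exact key y hy), intervalIntegral.integral_add
      (intervalIntegrable_of_integrableOn_Icc g.du_int) (by simp)]
    simp
  have e1 := f.ftc_u 1 (by simp)
  have e2 := g.ftc_u 1 (by simp)
  have := key x hx
  linarith

end W22

lemma exists_superlevel_integral_eq {p : ℝ → ℝ} (hp : Continuous p) {x₀ δ : ℝ}
    (hx₀ : x₀ ∈ Icc (0:ℝ) 1) (hmax : ∀ x ∈ Icc (0:ℝ) 1, p x ≤ p x₀) (hδ : 0 < δ) :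
    ∃ c₀ > 0, ∀ c, 0 < c → c ≤ c₀ →
      ∃ h, p x₀ - δ ≤ h ∧ h < p x₀ ∧ ∫ x in (0:ℝ)..1, max (p x - h) 0 = c := by
  set F : ℝ → ℝ := fun h => ∫ x in (0:ℝ)..1, max (p x - h) 0 with hF
  have hFc : Continuous F :=
    intervalIntegral.continuous_parametric_intervalIntegral_of_continuous
      (f := fun h x => max (p x - h) 0) (by unfold Function.uncurry; fun_prop) continuous_const
  have hFM : F (p x₀) = 0 := by
    rw [hF]
    refine (intervalIntegral.integral_congr (g := fun _ => (0:ℝ)) fun x hx => ?_).trans (by simp)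
    rw [uIcc_of_le zero_le_one] at hx
    exact max_eq_right (by linarith [hmax x hx])
  refine ⟨F (p x₀ - δ), ?_, fun c hc hcle => ?_⟩
  · refine intervalIntegral.integral_pos zero_lt_one (by fun_prop)
      (fun x _ => le_max_right _ _) ⟨x₀, hx₀, ?_⟩
    exact lt_max_of_lt_left (by linarith)
  · obtain ⟨h, hh, hhc⟩ := intermediate_value_Icc' (show p x₀ - δ ≤ p x₀ by linarith)
      hFc.continuousOn ⟨hFM.symm ▸ hc.le, hcle⟩
    refine ⟨h, hh.1, lt_of_le_of_ne hh.2 ?_, hhc⟩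
    rintro rfl
    exact hc.ne' (hhc.symm.trans hFM)

/-- A continuous function of mean zero taking both signs can be truncated from above and from
below, by an arbitrarily small amount, so that the mean is preserved. -/
lemma exists_clamp_integral_eq_zero {p : ℝ → ℝ} (hp : ContinuousOn p (Icc 0 1))
    (hint : ∫ x in (0:ℝ)..1, p x = 0) (hpos : ∃ x ∈ Icc (0:ℝ) 1, 0 < p x)
    (hneg : ∃ x ∈ Icc (0:ℝ) 1, p x < 0) {η : ℝ} (hη : 0 < η) :
    ∃ l h, l ≤ 0 ∧ 0 ≤ h ∧ (∫ x in (0:ℝ)..1, clamp l h (p x) = 0) ∧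
      (∀ x ∈ Icc (0:ℝ) 1, |clamp l h (p x) - p x| ≤ η) ∧ ∃ x ∈ Icc (0:ℝ) 1, h < p x := by
  set q : ℝ → ℝ := IccExtend zero_le_one ((Icc (0:ℝ) 1).domRestrict p) with hq
  have hqc : Continuous q := hp.domRestrict.Icc_extend'
  have hqp : ∀ x ∈ Icc (0:ℝ) 1, q x = p x := fun x hx => by
    rw [hq, IccExtend_of_mem _ _ hx, domRestrict_apply]
  obtain ⟨x₁, hx₁, hmax⟩ := isCompact_Icc.exists_isMaxOn (nonempty_Icc.2 zero_le_one)
    (hqc.continuousOn (s := Icc (0:ℝ) 1))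
  obtain ⟨x₂, hx₂, hmin⟩ := isCompact_Icc.exists_isMinOn (nonempty_Icc.2 zero_le_one)
    (hqc.continuousOn (s := Icc (0:ℝ) 1))
  have h1 : 0 < q x₁ := by
    obtain ⟨x, hx, h⟩ := hpos
    rw [← hqp x hx] at h
    exact h.trans_le (hmax hx)
  have h2 : q x₂ < 0 := by
    obtain ⟨x, hx, h⟩ := hneg
    rw [← hqp x hx] at h
    exact (hmin hx).trans_lt h
  obtain ⟨c₁, hc₁, H₁⟩ := exists_superlevel_integral_eq hqc hx₁ (fun x hx => hmax hx)
    (lt_min hη h1)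
  obtain ⟨c₂, hc₂, H₂⟩ := exists_superlevel_integral_eq hqc.neg hx₂
    (fun x hx => neg_le_neg (hmin hx)) (lt_min hη (neg_pos.2 h2))
  obtain ⟨h, hh1, hh2, hhc⟩ := H₁ (min c₁ c₂) (lt_min hc₁ hc₂) (min_le_left _ _)
  obtain ⟨k, hk1, hk2, hkc⟩ := H₂ (min c₁ c₂) (lt_min hc₁ hc₂) (min_le_right _ _)
  have a1 := min_le_left η (q x₁)
  have a2 := min_le_right η (q x₁)
  have b1 := min_le_left η (-q x₂)
  have b2 := min_le_right η (-q x₂)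
  simp only [Pi.neg_apply] at hk1 hk2 hkc
  have hh0 : 0 ≤ h := by linarith
  have hk0 : -k ≤ 0 := by linarith
  refine ⟨-k, h, hk0, hh0, ?_, fun x hx => ?_, x₁, hx₁, by rwa [← hqp x₁ hx₁]⟩
  · have e : ∫ x in (0:ℝ)..1, clamp (-k) h (p x) =
        ∫ x in (0:ℝ)..1, (q x - max (q x - h) 0 + max (-q x - k) 0) := by
      refine intervalIntegral.integral_congr fun x hx => ?_
      rw [uIcc_of_le zero_le_one] at hx
      simp only [hqp x hx]
      rw [clamp_eq_sub_add (hk0.trans hh0)]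
      ring_nf
    have e' : ∫ x in (0:ℝ)..1, q x = 0 := by
      refine (intervalIntegral.integral_congr fun x hx => ?_).trans hint
      rw [uIcc_of_le zero_le_one] at hx
      exact hqp x hx
    rw [e, intervalIntegral.integral_add, intervalIntegral.integral_sub, e', hhc, hkc]
    · ring
    all_goals exact Continuous.intervalIntegrable (by fun_prop) _ _
  · have m1 : q x ≤ q x₁ := hmax hx
    have m2 : q x₂ ≤ q x := hmin hx
    rw [← hqp x hx]
    rcases le_total (q x) (-k) with hl | hl
    · rw [clamp_of_le hl, abs_le]; constructor <;> linarith
    rcases le_total (q x) h with hr | hr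
    · rw [clamp_of_mem ⟨hl, hr⟩, sub_self, abs_zero]; exact hη.le
    · rw [clamp_of_ge (hk0.trans hh0) hr, abs_le]; constructor <;> linarith

lemma exists_gap {f g : ℝ → ℝ} (hf : ContinuousOn f (Icc 0 1)) (hg : ContinuousOn g (Icc 0 1))
    (h : ∀ x ∈ Icc (0:ℝ) 1, g x < f x) :
    ∃ η > 0, ∀ x ∈ Icc (0:ℝ) 1, g x + η ≤ f x := by
  obtain ⟨x₀, hx₀, hmin⟩ := isCompact_Icc.exists_isMinOn (nonempty_Icc.2 zero_le_one) (hf.sub hg)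
  refine ⟨f x₀ - g x₀, sub_pos.2 (h x₀ hx₀), fun x hx => ?_⟩
  have : f x₀ - g x₀ ≤ f x - g x := hmin hx
  linarith

lemma exists_pos_of_integral_pos {p : ℝ → ℝ} {a b : ℝ} (hab : a ≤ b)
    (h : 0 < ∫ x in a..b, p x) : ∃ x ∈ Icc a b, 0 < p x := by
  by_contra! hc
  have := intervalIntegral.integral_nonneg (μ := volume) (f := fun x => -p x) hab
    fun x hx => neg_nonneg.2 (hc x hx)
  rw [intervalIntegral.integral_neg] at this
  linarith

/-- A minimizer of the penalized energy in `G_ψ` touches the obstacle. -/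
theorem stmt9 (ψ : ℝ → ℝ) (hψ : Admissible ψ) (ε : ℝ) (hε : 0 ≤ ε) (u : W22)
    (hu : MemG ψ u) (hmin : ∀ w : W22, MemG ψ w → graphPE ε u ≤ graphPE ε w) :
    ∃ x₀ ∈ Ioo (0:ℝ) 1, u.u x₀ = ψ x₀ := by
  by_contra! hno
  obtain ⟨hu0, hu1, huψ⟩ := hu
  have hlt : ∀ x ∈ Icc (0:ℝ) 1, ψ x < u.u x := by
    intro x hx
    rcases eq_or_lt_of_le hx.1 with rfl | h0
    · rw [hu0]; exact hψ.neg0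
    rcases eq_or_lt_of_le hx.2 with rfl | h1
    · rw [hu1]; exact hψ.neg1
    exact lt_of_le_of_ne (huψ x hx) (hno x ⟨h0, h1⟩).symm
  obtain ⟨η, hη, hgap⟩ := exists_gap u.continuousOn_u hψ.cont hlt
  have hI : IntervalIntegrable u.du volume 0 1 := intervalIntegrable_of_integrableOn_Icc u.du_int
  have hint : ∫ x in (0:ℝ)..1, u.du x = 0 := by
    have := u.ftc_u 1 (by simp)
    linarith
  obtain ⟨x, hx, hxpos⟩ := hψ.pos
  have hI0 : IntervalIntegrable u.du volume 0 x := hI.mono_set (by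
    rw [uIcc_of_le hx.1, uIcc_of_le zero_le_one]; exact Icc_subset_Icc_right hx.2)
  have hI1 : IntervalIntegrable u.du volume x 1 := hI.mono_set (by
    rw [uIcc_of_le hx.2, uIcc_of_le zero_le_one]; exact Icc_subset_Icc_left hx.1)
  have hI0pos : 0 < ∫ s in (0:ℝ)..x, u.du s := by
    have := u.ftc_u x hx
    linarith [huψ x hx]
  have hI1neg : 0 < ∫ s in x..1, -u.du s := by
    have := intervalIntegral.integral_add_adjacent_intervals hI0 hI1
    rw [intervalIntegral.integral_neg]
    linarith
  obtain ⟨a, ha, hapos⟩ := exists_pos_of_integral_pos hx.1 hI0pos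
  obtain ⟨b, hb, hbneg⟩ := exists_pos_of_integral_pos hx.2 hI1neg
  obtain ⟨l, h, hl, hh, hclamp, hclose, y, hy, hhy⟩ := exists_clamp_integral_eq_zero
    u.continuousOn_du hint ⟨a, Icc_subset_Icc_right hx.2 ha, hapos⟩
    ⟨b, Icc_subset_Icc_left hx.1 hb, by linarith⟩ hη
  have hw0 : (u.truncate (hl.trans hh)).u 0 = 0 := by simp [W22.truncate]
  have hw1 : (u.truncate (hl.trans hh)).u 1 = 0 := hclamp
  have hmem : MemG ψ (u.truncate (hl.trans hh)) := by
    refine ⟨hw0, hw1, fun z hz => ?_⟩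
    have hz' : Icc 0 z ⊆ Icc (0:ℝ) 1 := Icc_subset_Icc_right hz.2
    have hd : |∫ s in (0:ℝ)..z, (clamp l h (u.du s) - u.du s)| ≤ η * |z - 0| := by
      refine intervalIntegral.norm_integral_le_of_norm_le_const (E := ℝ) fun s hs => ?_
      rw [uIoc_of_le hz.1] at hs
      exact hclose s (hz' (Ioc_subset_Icc_self hs))
    rw [intervalIntegral.integral_sub] at hd
    · have e := u.ftc_u z hz
      have hd' := (abs_le.1 hd).1
      rw [sub_zero, abs_of_nonneg hz.1] at hd'
      have : η * z ≤ η := mul_le_of_le_one_right hη.le hz.2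
      have := hgap z hz
      change ψ z ≤ ∫ s in (0:ℝ)..z, clamp l h (u.du s)
      linarith
    · exact ((continuous_clamp l h).comp_continuousOn
        (u.continuousOn_du.mono hz')).intervalIntegrable_of_Icc hz.1
    · exact (u.continuousOn_du.mono hz').intervalIntegrable_of_Icc hz.1
  have hE : graphE u ≤ graphE (u.truncate (hl.trans hh)) := by
    have h1 := hmin _ hmem
    have h2 := mul_le_mul_of_nonneg_left (u.graphLen_truncate_le hl hh) hε
    unfold graphPE at h1
    linarith
  have hdu : (u.truncate (hl.trans hh)).du y = u.du y :=
    W22.du_eq_of_ddu_eq (u.ae_ddu_eq_of_graphE_le _ hE) (hw0.trans hu0.symm)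
      (hw1.trans hu1.symm) hy
  have : (u.truncate (hl.trans hh)).du y ≤ h := clamp_le (hl.trans hh) _
  linarith
end
end
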